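/- arXiv:1204.4883 — 5 statements merged into one kernel-verified Lean document; each statement's English description precedes it below -/
import Mathlib

section
/- Let N ≥ 1 be an integer and 0 < α ≤ 1. Then there is a constant C > 0, depending only on N and α, such that for every bounded function U : ℝ^N → ℝ that is α-Hölder with constant H, and every smooth compactly supported function w : ℝ^N → ℝ, one has |∫_{ℝ^N} U · Δw dx| ≤ C · H · ‖w‖_{L¹}^{α/2} · ‖Δw‖_{L¹}^{1−α/2}, where Δ is the Laplacian and ‖·‖_{L¹} is the L¹ norm with respect to Lebesgue measure. -/
open MeasureTheory

/-- The Laplacian of `w : ℝ^N → ℝ`, as the sum of the second partial derivatives in the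
standard orthonormal coordinates of `EuclideanSpace ℝ (Fin N)`. -/
noncomputable def eLaplacian {N : ℕ} (w : EuclideanSpace ℝ (Fin N) → ℝ)
    (x : EuclideanSpace ℝ (Fin N)) : ℝ :=
  ∑ i : Fin N,
    fderiv ℝ (fun z => fderiv ℝ w z (EuclideanSpace.single i 1)) x (EuclideanSpace.single i 1)

section Smoothness

variable {F : Type*} [NormedAddCommGroup F] [NormedSpace ℝ F]

lemma ContDiff.fderiv_apply_const {w : F → ℝ} (hw : ContDiff ℝ (⊤ : ℕ∞) w) (v : F) :
    ContDiff ℝ (⊤ : ℕ∞) (fun z => fderiv ℝ w z v) :=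
  (hw.fderiv_right (m := (⊤ : ℕ∞)) (by norm_cast)).clm_apply contDiff_const

lemma fderiv_comp_sub_smul {w : F → ℝ} (hw : Differentiable ℝ w) (ε : ℝ) (z y v : F) :
    fderiv ℝ (fun y => w (z - ε • y)) y v = -ε * fderiv ℝ w (z - ε • y) v := by
  have h : HasFDerivAt (fun y : F => z - ε • y) (-(ε • ContinuousLinearMap.id ℝ F)) y :=
    ((hasFDerivAt_id y).const_smul ε).const_sub z
  have h2 : HasFDerivAt (fun y => w (z - ε • y)) _ y := (hw _).hasFDerivAt.comp y h
  rw [h2.fderiv]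
  simp

end Smoothness

section Laplacian

variable {N : ℕ}

lemma continuous_eLaplacian {w : EuclideanSpace ℝ (Fin N) → ℝ} (hw : ContDiff ℝ (⊤ : ℕ∞) w) :
    Continuous (eLaplacian w) :=
  continuous_finsetSum _ fun _ _ =>
    ((hw.fderiv_apply_const _).fderiv_apply_const _).continuous

lemma hasCompactSupport_eLaplacian {w : EuclideanSpace ℝ (Fin N) → ℝ}
    (hw : HasCompactSupport w) : HasCompactSupport (eLaplacian w) := by
  refine HasCompactSupport.intro hw fun x hx => Finset.sum_eq_zero fun i _ => ?_
  let e := EuclideanSpace.single i (1 : ℝ)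
  have h : tsupport (fun z => fderiv ℝ (fun z => fderiv ℝ w z e) z e) ⊆ tsupport w :=
    (tsupport_fderiv_apply_subset ℝ e).trans (tsupport_fderiv_apply_subset ℝ e)
  exact image_eq_zero_of_notMem_tsupport
    (f := fun z => fderiv ℝ (fun z => fderiv ℝ w z e) z e) fun hx' => hx (h hx')

lemma eLaplacian_comp_sub_smul {w : EuclideanSpace ℝ (Fin N) → ℝ}
    (hw : ContDiff ℝ (⊤ : ℕ∞) w) (ε : ℝ) (z y : EuclideanSpace ℝ (Fin N)) :
    eLaplacian (fun y => w (z - ε • y)) y = ε ^ 2 * eLaplacian w (z - ε • y) := by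
  have hne : ((⊤ : ℕ∞) : WithTop ℕ∞) ≠ 0 := by simp
  simp only [eLaplacian, Finset.mul_sum]
  refine Finset.sum_congr rfl fun i _ => ?_
  simp only [fderiv_comp_sub_smul (hw.differentiable hne)]
  have hd : DifferentiableAt ℝ (fun y => fderiv ℝ w (z - ε • y) (EuclideanSpace.single i 1)) y :=
    ((hw.fderiv_apply_const (EuclideanSpace.single i 1)).differentiable hne _).comp y
      (by fun_prop)
  rw [fderiv_const_mul hd]
  have := fderiv_comp_sub_smul ((hw.fderiv_apply_const
    (EuclideanSpace.single i 1)).differentiable hne) ε z y (EuclideanSpace.single i 1)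
  simp only [smul_apply, this, smul_eq_mul]
  ring

lemma integral_mul_eLaplacian_comm {u v : EuclideanSpace ℝ (Fin N) → ℝ}
    (hu : ContDiff ℝ (⊤ : ℕ∞) u) (hu' : HasCompactSupport u) (hv : ContDiff ℝ (⊤ : ℕ∞) v) :
    ∫ x, u x * eLaplacian v x = ∫ x, eLaplacian u x * v x := by
  have hne : ((⊤ : ℕ∞) : WithTop ℕ∞) ≠ 0 := by simp
  have key : ∀ {f g : EuclideanSpace ℝ (Fin N) → ℝ}, ContDiff ℝ (⊤ : ℕ∞) f →
      HasCompactSupport f → ContDiff ℝ (⊤ : ℕ∞) g → Integrable (fun x => f x * g x) := by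
    intro f g hf hf' hg
    exact (hf.continuous.mul hg.continuous).integrable_of_hasCompactSupport hf'.mul_right
  have parts : ∀ {f g : EuclideanSpace ℝ (Fin N) → ℝ} (e : EuclideanSpace ℝ (Fin N)),
      ContDiff ℝ (⊤ : ℕ∞) f → HasCompactSupport f → ContDiff ℝ (⊤ : ℕ∞) g →
      ∫ x, f x * fderiv ℝ g x e = -∫ x, fderiv ℝ f x e * g x := by
    intro f g e hf hf' hg
    exact integral_mul_fderiv_eq_neg_fderiv_mul_of_integrable
      (key (hf.fderiv_apply_const e) (hf'.fderiv_apply ℝ e) hg)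
      (key hf hf' (hg.fderiv_apply_const e)) (key hf hf' hg)
      (fun x _ => hf.differentiable hne x) (fun x _ => hg.differentiable hne x)
  simp only [eLaplacian, Finset.mul_sum, Finset.sum_mul]
  rw [integral_finsetSum _ fun i _ => key hu hu'
      ((hv.fderiv_apply_const _).fderiv_apply_const _),
    integral_finsetSum _ fun i _ => key ((hu.fderiv_apply_const _).fderiv_apply_const _)
      ((hu'.fderiv_apply ℝ _).fderiv_apply ℝ _) hv]
  refine Finset.sum_congr rfl fun i _ => ?_
  rw [parts _ hu hu' (hv.fderiv_apply_const _),
    parts _ (hu.fderiv_apply_const _) (hu'.fderiv_apply ℝ _) hv, neg_neg]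

lemma integral_eLaplacian_eq_zero {u : EuclideanSpace ℝ (Fin N) → ℝ}
    (hu : ContDiff ℝ (⊤ : ℕ∞) u) (hu' : HasCompactSupport u) : ∫ x, eLaplacian u x = 0 := by
  have h := integral_mul_eLaplacian_comm hu hu' (contDiff_const (c := (1 : ℝ)))
  simpa [eLaplacian] using h.symm

end Laplacian

section Averages

variable {N : ℕ} {U f g : EuclideanSpace ℝ (Fin N) → ℝ} {ε : ℝ}

lemma hasCompactSupport_uncurry_average (hf' : HasCompactSupport f)
    (hg' : HasCompactSupport g) :
    HasCompactSupport (Function.uncurry fun x y => U (x + ε • y) * f y * g x) := by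
  refine HasCompactSupport.intro (hg'.isCompact.prod hf'.isCompact) fun p hp => ?_
  by_cases h : p.1 ∈ tsupport g
  · have h2 : f p.2 = 0 := image_eq_zero_of_notMem_tsupport fun h2 => hp ⟨h, h2⟩
    simp [Function.uncurry, h2]
  · simp [Function.uncurry, image_eq_zero_of_notMem_tsupport h]

lemma integrable_average (hU : Continuous U) (hf : Continuous f) (hf' : HasCompactSupport f)
    (hg : Continuous g) (hg' : HasCompactSupport g) :
    Integrable fun x => (∫ y, U (x + ε • y) * f y) * g x := by
  have hc : Continuous (Function.uncurry fun x y => U (x + ε • y) * f y * g x) := by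
    simp only [Function.uncurry_def]; fun_prop
  have := (hc.integrable_of_hasCompactSupport (μ := volume.prod volume)
    (hasCompactSupport_uncurry_average hf' hg')).integral_prod_left
  simpa only [Function.uncurry, integral_mul_const] using this

lemma integral_average_mul (hU : Continuous U) (hf : Continuous f) (hf' : HasCompactSupport f)
    (hg : Continuous g) (hg' : HasCompactSupport g) :
    ∫ x, (∫ y, U (x + ε • y) * f y) * g x = ∫ z, U z * ∫ y, f y * g (z - ε • y) := by
  have hc : Continuous (Function.uncurry fun x y => U (x + ε • y) * f y * g x) := by
    simp only [Function.uncurry_def]; fun_prop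
  have hc₂ : Continuous (Function.uncurry fun y z => U z * f y * g (z - ε • y)) := by
    simp only [Function.uncurry_def]; fun_prop
  have hs₂ : HasCompactSupport (Function.uncurry fun y z => U z * f y * g (z - ε • y)) := by
    refine HasCompactSupport.intro ((hg'.isCompact.prod hf'.isCompact).image
      (f := fun p => (p.2, p.1 + ε • p.2)) (by fun_prop)) fun p hp => ?_
    by_cases h : p.1 ∈ tsupport f
    · have h2 : g (p.2 - ε • p.1) = 0 := image_eq_zero_of_notMem_tsupport fun h2 =>
        hp ⟨(p.2 - ε • p.1, p.1), ⟨h2, h⟩, by simp⟩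
      simp [Function.uncurry, h2]
    · simp [Function.uncurry, image_eq_zero_of_notMem_tsupport h]
  calc ∫ x, (∫ y, U (x + ε • y) * f y) * g x
      = ∫ x, ∫ y, U (x + ε • y) * f y * g x := by simp only [integral_mul_const]
    _ = ∫ y, ∫ x, U (x + ε • y) * f y * g x :=
        integral_integral_swap_of_hasCompactSupport hc
          (hasCompactSupport_uncurry_average hf' hg')
    _ = ∫ y, ∫ z, U z * f y * g (z - ε • y) := by
        congr 1; ext y
        rw [← integral_sub_right_eq_self (fun x => U (x + ε • y) * f y * g x) (ε • y)]
        simp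
    _ = ∫ z, ∫ y, U z * f y * g (z - ε • y) :=
        integral_integral_swap_of_hasCompactSupport hc₂ hs₂
    _ = _ := by simp only [mul_assoc, integral_const_mul]

lemma integral_average_sub (hU : Continuous U) (hf : Continuous f) (hf' : HasCompactSupport f)
    (x : EuclideanSpace ℝ (Fin N)) :
    ∫ y, (U (x + ε • y) - U x) * f y = (∫ y, U (x + ε • y) * f y) - U x * ∫ y, f y := by
  simp only [sub_mul]
  rw [integral_sub, integral_const_mul]
  · exact Continuous.integrable_of_hasCompactSupport (by fun_prop) hf'.mul_left
  · exact Continuous.integrable_of_hasCompactSupport (by fun_prop) hf'.mul_left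

lemma abs_integral_average_sub_mul_le {H α : ℝ} (hα : 0 < α)
    (hUH : ∀ x y, |U x - U y| ≤ H * ‖x - y‖ ^ α) (hε : 0 < ε)
    (hf : Continuous f) (hf' : HasCompactSupport f)
    (hg : Continuous g) (hg' : HasCompactSupport g) :
    |∫ x, (∫ y, (U (x + ε • y) - U x) * f y) * g x|
      ≤ H * ε ^ α * (∫ y, ‖y‖ ^ α * |f y|) * ∫ x, |g x| := by
  have hint : Integrable fun y => ‖y‖ ^ α * |f y| :=
    Continuous.integrable_of_hasCompactSupport
      ((continuous_norm.rpow_const fun _ => Or.inr hα.le).mul hf.abs) hf'.norm.mul_left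
  have hin : ∀ x, |∫ y, (U (x + ε • y) - U x) * f y|
      ≤ H * ε ^ α * ∫ y, ‖y‖ ^ α * |f y| := by
    intro x
    rw [← integral_const_mul, ← Real.norm_eq_abs]
    refine norm_integral_le_of_norm_le (hint.const_mul _) (.of_forall fun y => ?_)
    rw [Real.norm_eq_abs, abs_mul]
    have h := hUH (x + ε • y) x
    rw [add_sub_cancel_left, norm_smul, Real.norm_of_nonneg hε.le,
      Real.mul_rpow hε.le (norm_nonneg _)] at h
    calc _ ≤ H * (ε ^ α * ‖y‖ ^ α) * |f y| := by gcongr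
      _ = _ := by ring
  rw [← integral_const_mul, ← Real.norm_eq_abs]
  refine norm_integral_le_of_norm_le
    ((hg.integrable_of_hasCompactSupport hg').abs.const_mul _) (.of_forall fun x => ?_)
  rw [Real.norm_eq_abs, abs_mul]
  exact mul_le_mul_of_nonneg_right (hin x) (abs_nonneg _)

lemma abs_integral_mul_eLaplacian_le_of_scale {H α : ℝ} (hα : 0 < α) (hU : Continuous U)
    (hUH : ∀ x y, |U x - U y| ≤ H * ‖x - y‖ ^ α) (hε : 0 < ε)
    {φ w : EuclideanSpace ℝ (Fin N) → ℝ}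
    (hφ : ContDiff ℝ (⊤ : ℕ∞) φ) (hφ' : HasCompactSupport φ) (hφ1 : ∫ y, φ y = 1)
    (hw : ContDiff ℝ (⊤ : ℕ∞) w) (hw' : HasCompactSupport w) :
    |∫ x, U x * eLaplacian w x|
      ≤ H * ε ^ α * (∫ y, ‖y‖ ^ α * |φ y|) * (∫ x, |eLaplacian w x|)
        + (ε ^ 2)⁻¹ * (H * ε ^ α * (∫ y, ‖y‖ ^ α * |eLaplacian φ y|) * ∫ x, |w x|) := by
  have hΔw := continuous_eLaplacian hw
  have hΔw' := hasCompactSupport_eLaplacian hw'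
  have hΔφ := continuous_eLaplacian hφ
  have hΔφ' := hasCompactSupport_eLaplacian hφ'
  have hfar : ∫ x, (∫ y, U (x + ε • y) * φ y) * eLaplacian w x
      = (ε ^ 2)⁻¹ * ∫ x, (∫ y, (U (x + ε • y) - U x) * eLaplacian φ y) * w x := by
    simp only [integral_average_sub hU hΔφ hΔφ', integral_eLaplacian_eq_zero hφ hφ', mul_zero,
      sub_zero]
    rw [integral_average_mul hU hφ.continuous hφ' hΔw hΔw',
      integral_average_mul hU hΔφ hΔφ' hw.continuous hw', ← integral_const_mul]
    congr 1; ext z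
    have hz : ContDiff ℝ (⊤ : ℕ∞) fun y => w (z - ε • y) := hw.comp (by fun_prop)
    rw [← integral_mul_eLaplacian_comm hφ hφ' hz]
    simp only [eLaplacian_comp_sub_smul hw, mul_left_comm _ (ε ^ 2), integral_const_mul]
    field_simp
  have hnear : ∫ x, (∫ y, (U (x + ε • y) - U x) * φ y) * eLaplacian w x
      = (∫ x, (∫ y, U (x + ε • y) * φ y) * eLaplacian w x) - ∫ x, U x * eLaplacian w x := by
    simp only [integral_average_sub hU hφ.continuous hφ', hφ1, mul_one]
    simp only [sub_mul]
    exact integral_sub (integrable_average hU hφ.continuous hφ' hΔw hΔw')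
      (Continuous.integrable_of_hasCompactSupport (hU.mul hΔw) hΔw'.mul_left)
  have h1 := abs_integral_average_sub_mul_le hα hUH hε hφ.continuous hφ' hΔw hΔw'
  have h2 := abs_integral_average_sub_mul_le hα hUH hε hΔφ hΔφ' hw.continuous hw'
  have h3 : ∫ x, U x * eLaplacian w x
      = (ε ^ 2)⁻¹ * (∫ x, (∫ y, (U (x + ε • y) - U x) * eLaplacian φ y) * w x)
        - ∫ x, (∫ y, (U (x + ε • y) - U x) * φ y) * eLaplacian w x := by
    rw [hnear, hfar]; ring
  rw [h3, add_comm]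
  refine (abs_sub _ _).trans (add_le_add ?_ h1)
  rw [abs_mul, abs_of_pos (by positivity : 0 < (ε ^ 2)⁻¹)]
  gcongr

end Averages

lemma continuous_of_abs_sub_le_rpow {F : Type*} [NormedAddCommGroup F] {U : F → ℝ} {H α : ℝ}
    (hα : 0 < α) (hUH : ∀ x y, |U x - U y| ≤ H * ‖x - y‖ ^ α) : Continuous U := by
  refine continuous_iff_continuousAt.2 fun x => tendsto_iff_norm_sub_tendsto_zero.2 ?_
  refine squeeze_zero (fun _ => norm_nonneg _) (fun y => hUH y x) ?_
  have h : Continuous fun y => H * ‖y - x‖ ^ α :=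
    continuous_const.mul ((continuous_id.sub continuous_const).norm.rpow_const
      fun _ => Or.inr hα.le)
  simpa [Real.zero_rpow hα.ne'] using h.tendsto x

lemma Continuous.eq_zero_of_integral_abs_eq_zero {N : ℕ} {g : EuclideanSpace ℝ (Fin N) → ℝ}
    (hg : Continuous g) (hg' : HasCompactSupport g) (h : ∫ x, |g x| = 0) : g = 0 := by
  have h2 := (integral_eq_zero_iff_of_nonneg (fun x => abs_nonneg (g x))
    (hg.integrable_of_hasCompactSupport hg').abs).1 h
  have h3 := (hg.abs.ae_eq_iff_eq volume continuous_zero).1 h2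
  ext x
  simpa using congrFun h3 x

/-- For bounded `α`-Hölder `U` with constant `H` and smooth compactly supported `w`:
`|∫ U Δw| ≤ C H ‖w‖₁^{α/2} ‖Δw‖₁^{1−α/2}`. -/
theorem stmt_7 (N : ℕ) (hN : 1 ≤ N) (α : ℝ) (hα0 : 0 < α) (hα1 : α ≤ 1) :
    ∃ C > 0, ∀ (U : EuclideanSpace ℝ (Fin N) → ℝ) (H : ℝ),
      (∃ B : ℝ, ∀ x, |U x| ≤ B) →
      (∀ x y, |U x - U y| ≤ H * ‖x - y‖ ^ α) →
      ∀ w : EuclideanSpace ℝ (Fin N) → ℝ, ContDiff ℝ (⊤ : ℕ∞) w → HasCompactSupport w →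
        |∫ x, U x * eLaplacian w x|
          ≤ C * H * (∫ x, |w x|) ^ (α / 2) * (∫ x, |eLaplacian w x|) ^ (1 - α / 2) := by
  obtain ⟨φ, hφ, hφ', hφ1⟩ : ∃ φ : EuclideanSpace ℝ (Fin N) → ℝ,
      ContDiff ℝ (⊤ : ℕ∞) φ ∧ HasCompactSupport φ ∧ ∫ y, φ y = 1 := by
    let b : ContDiffBump (0 : EuclideanSpace ℝ (Fin N)) := ⟨1, 2, by norm_num, by norm_num⟩
    exact ⟨b.normed volume, b.contDiff_normed, b.hasCompactSupport_normed, b.integral_normed⟩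
  set m₁ := ∫ y, ‖y‖ ^ α * |φ y| with hm₁
  set m₂ := ∫ y, ‖y‖ ^ α * |eLaplacian φ y| with hm₂
  have hm₁0 : 0 ≤ m₁ := integral_nonneg fun y => by positivity
  have hm₂0 : 0 ≤ m₂ := integral_nonneg fun y => by positivity
  refine ⟨m₁ + m₂ + 1, by positivity, fun U H _ hUH w hw hw' => ?_⟩
  have hH : 0 ≤ H := by
    have h := hUH (EuclideanSpace.single ⟨0, hN⟩ 1) 0
    rw [sub_zero _, PiLp.norm_single, norm_one, Real.one_rpow, mul_one] at h
    exact (abs_nonneg _).trans h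
  have hU := continuous_of_abs_sub_le_rpow hα0 hUH
  have hscale := fun ε (hε : 0 < ε) =>
    abs_integral_mul_eLaplacian_le_of_scale hα0 hU hUH hε hφ hφ' hφ1 hw hw'
  simp only [← hm₁, ← hm₂] at hscale
  have ha0 : 0 ≤ ∫ x, |w x| := integral_nonneg fun x => abs_nonneg _
  have hb0 : 0 ≤ ∫ x, |eLaplacian w x| := integral_nonneg fun x => abs_nonneg _
  rcases hb0.eq_or_lt with hb | hb
  · have h0 := (continuous_eLaplacian hw).eq_zero_of_integral_abs_eq_zero
      (hasCompactSupport_eLaplacian hw') hb.symm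
    calc |∫ x, U x * eLaplacian w x| = 0 := by simp [h0]
      _ ≤ _ := by positivity
  rcases ha0.eq_or_lt with ha | ha
  · have h0 := hw.continuous.eq_zero_of_integral_abs_eq_zero hw' ha.symm
    simp [h0, eLaplacian] at hb
  generalize ∫ x, |w x| = a at *
  generalize ∫ x, |eLaplacian w x| = b at *
  refine (hscale ((a / b) ^ (1 / 2 : ℝ)) (by positivity)).trans ?_
  have hε2 : ((a / b) ^ (1 / 2 : ℝ)) ^ 2 = a / b := by
    rw [← Real.sqrt_eq_rpow, Real.sq_sqrt (by positivity)]
  have hεα : ((a / b) ^ (1 / 2 : ℝ)) ^ α * b = a ^ (α / 2) * b ^ (1 - α / 2) := by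
    rw [← Real.rpow_mul (by positivity), Real.div_rpow ha.le hb.le, Real.rpow_sub hb,
      Real.rpow_one, one_div_mul_eq_div]
    ring
  rw [hε2]
  calc _ = (m₁ + m₂) * H * (((a / b) ^ (1 / 2 : ℝ)) ^ α * b) := by field_simp
    _ ≤ (m₁ + m₂ + 1) * H * (((a / b) ^ (1 / 2 : ℝ)) ^ α * b) :=
        by gcongr ?_ * H * _; linarith
    _ = _ := by rw [hεα]; ring
end

section
/- Let N ≥ 1 be an integer and 0 < α ≤ 1. Then there is a constant C > 0, depending only on N and α, such that for every bounded function V : ℝ^N → ℝ that is α-Hölder with constant H, every smooth compactly supported function w : ℝ^N → ℝ, and every 1 ≤ i ≤ N, one has |∫_{ℝ^N} V · ∂_i w dx| ≤ C · H · ‖w‖_{L¹}^{α} · ‖∇w‖_{L¹}^{1−α}, where ‖∇w‖_{L¹} := ∫_{ℝ^N} |∇w(x)| dx. -/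
open MeasureTheory

section HolderPairing

variable {E : Type*} [NormedAddCommGroup E]

/-- A function satisfying a Hölder bound with positive exponent is continuous. -/
lemma continuous_of_abs_sub_le_rpow_s8 {V : E → ℝ} {H α : ℝ} (hα : 0 < α)
    (hV : ∀ x y, |V x - V y| ≤ H * ‖x - y‖ ^ α) : Continuous V := by
  rw [continuous_iff_continuousAt]
  intro y
  rw [ContinuousAt, tendsto_iff_norm_sub_tendsto_zero]
  refine squeeze_zero (fun _ => norm_nonneg _) (fun x => hV x y) ?_
  have hc : Continuous fun x : E => H * ‖x - y‖ ^ α :=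
    continuous_const.mul ((continuous_id.sub continuous_const).norm.rpow_const
      fun _ => Or.inr hα.le)
  simpa [Real.zero_rpow hα.ne'] using hc.tendsto y

variable [MeasurableSpace E] [BorelSpace E] {μ : Measure E} [IsFiniteMeasureOnCompacts μ]

/-- Pairing the increment of a Hölder function with an integrable function. -/
lemma abs_integral_mul_translate_sub_le [μ.IsAddRightInvariant] {V u : E → ℝ} {H α : ℝ}
    (hVc : Continuous V) (hV : ∀ x y, |V x - V y| ≤ H * ‖x - y‖ ^ α)
    (hu : Continuous u) (hus : HasCompactSupport u) (v : E) :
    |(∫ x, V x * u (x + v) ∂μ) - ∫ x, V x * u x ∂μ| ≤ H * ‖v‖ ^ α * ∫ x, |u x| ∂μ := by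
  have h1 : ∫ x, V x * u (x + v) ∂μ = ∫ x, V (x - v) * u x ∂μ := by
    rw [← integral_add_right_eq_self (fun x => V (x - v) * u x) v]
    simp
  rw [h1, ← integral_sub, ← integral_const_mul]
  · refine norm_integral_le_of_norm_le (f := fun x => V (x - v) * u x - V x * u x) ?_
      (.of_forall fun x => ?_)
    · exact ((hu.integrable_of_hasCompactSupport hus).abs).const_mul _
    · rw [← sub_mul, norm_mul]
      refine mul_le_mul_of_nonneg_right ?_ (abs_nonneg _)
      simpa using hV (x - v) x
  · exact ((hVc.comp (by fun_prop)).mul hu).integrable_of_hasCompactSupport hus.mul_left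
  · exact (hVc.mul hu).integrable_of_hasCompactSupport hus.mul_left

variable [NormedSpace ℝ E]

/-- Differentiation under the integral sign of `t ↦ ∫ V(x) w(x + t e)`. -/
lemma hasDerivAt_integral_mul_translate [SecondCountableTopology E] {V w : E → ℝ}
    (hVc : Continuous V) {B : ℝ} (hB : ∀ x, |V x| ≤ B) (hw : ContDiff ℝ 1 w)
    (hws : HasCompactSupport w) (e : E) (t₀ : ℝ) :
    HasDerivAt (fun t : ℝ => ∫ x, V x * w (x + t • e) ∂μ)
      (∫ x, V x * fderiv ℝ w (x + t₀ • e) e ∂μ) t₀ := by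
  have hfc : Continuous (fderiv ℝ w) := hw.continuous_fderiv one_ne_zero
  obtain ⟨M, hM⟩ := (hws.fderiv ℝ).exists_bound_of_continuous hfc
  set K : Set E := (fun p : E × ℝ => p.1 - p.2 • e) '' (tsupport w ×ˢ Metric.closedBall t₀ 1)
    with hKdef
  have hK : IsCompact K :=
    (hws.isCompact.prod (isCompact_closedBall t₀ 1)).image (by fun_prop)
  have hwt : ∀ t : ℝ, HasCompactSupport fun x => w (x + t • e) := fun t =>
    hws.comp_homeomorph (Homeomorph.addRight (t • e))
  refine (hasDerivAt_integral_of_dominated_loc_of_deriv_le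
    (F := fun t x => V x * w (x + t • e))
    (F' := fun t x => V x * fderiv ℝ w (x + t • e) e)
    (bound := K.indicator fun _ => B * (M * ‖e‖))
    (Metric.ball_mem_nhds t₀ one_pos) ?_ ?_ ?_ ?_ ?_ ?_).2
  · exact .of_forall fun t => (hVc.mul (hw.continuous.comp (by fun_prop))).aestronglyMeasurable
  · exact (hVc.mul (hw.continuous.comp (by fun_prop))).integrable_of_hasCompactSupport
      (hwt t₀).mul_left
  · exact (hVc.mul ((hfc.comp (by fun_prop)).clm_apply
      continuous_const)).aestronglyMeasurable
  · refine .of_forall fun x t ht => ?_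
    by_cases hx : x ∈ K
    · rw [Set.indicator_of_mem hx, norm_mul]
      refine mul_le_mul (hB x) ?_ (norm_nonneg _) ((abs_nonneg _).trans (hB x))
      exact (ContinuousLinearMap.le_opNorm _ _).trans
        (mul_le_mul_of_nonneg_right (hM _) (norm_nonneg _))
    · have hxt : x + t • e ∉ tsupport w := fun h =>
        hx ⟨(x + t • e, t), ⟨h, Metric.ball_subset_closedBall ht⟩, by simp⟩
      have h0 : fderiv ℝ w (x + t • e) = 0 := by
        by_contra h
        exact hxt (support_fderiv_subset ℝ h)
      simp [h0, hx]
  · rw [integrable_indicator_iff hK.measurableSet]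
    exact integrableOn_const hK.measure_ne_top
  · refine .of_forall fun x t _ => ?_
    have h1 : HasDerivAt (fun t : ℝ => x + t • e) e t := by
      simpa using ((hasDerivAt_id t).smul_const e).const_add x
    exact (((hw.differentiable one_ne_zero _).hasFDerivAt.comp_hasDerivAt t h1)).const_mul (V x)

/-- The two-term estimate at scale `ε` for the pairing of a Hölder function with a directional
derivative. -/
lemma abs_integral_mul_fderiv_le [SecondCountableTopology E] [μ.IsAddRightInvariant]
    {V w : E → ℝ} {H α : ℝ} (hH : 0 ≤ H) (hα : 0 < α)
    (hV : ∀ x y, |V x - V y| ≤ H * ‖x - y‖ ^ α) {B : ℝ} (hB : ∀ x, |V x| ≤ B)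
    (hw : ContDiff ℝ 1 w) (hws : HasCompactSupport w) {e : E} (he : ‖e‖ = 1)
    {ε : ℝ} (hε : 0 < ε) :
    |∫ x, V x * fderiv ℝ w x e ∂μ|
      ≤ H * ε ^ α * (∫ x, ‖fderiv ℝ w x‖ ∂μ) + H * ε ^ α * (∫ x, |w x| ∂μ) / ε := by
  have hVc := continuous_of_abs_sub_le_rpow_s8 hα hV
  have hfc : Continuous (fderiv ℝ w) := hw.continuous_fderiv one_ne_zero
  have hder := hasDerivAt_integral_mul_translate (μ := μ) hVc hB hw hws e
  obtain ⟨ξ, hξ, hslope⟩ := exists_hasDerivAt_eq_slope _ _ hε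
    (fun t _ => (hder t).continuousAt.continuousWithinAt) (fun t _ => hder t)
  have hec : Continuous fun x => fderiv ℝ w x e := hfc.clm_apply continuous_const
  have hes : HasCompactSupport fun x => fderiv ℝ w x e := hws.fderiv_apply ℝ e
  have h1 := abs_integral_mul_translate_sub_le (μ := μ) hVc hV hec hes (ξ • e)
  have h2 := abs_integral_mul_translate_sub_le (μ := μ) hVc hV hw.continuous hws (ε • e)
  have hle : ∫ x, |fderiv ℝ w x e| ∂μ ≤ ∫ x, ‖fderiv ℝ w x‖ ∂μ := by
    refine integral_mono (hec.integrable_of_hasCompactSupport hes).abs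
      (hfc.integrable_of_hasCompactSupport (hws.fderiv ℝ)).norm fun x => ?_
    simpa [he] using (fderiv ℝ w x).le_opNorm e
  rw [norm_smul, he, mul_one, Real.norm_of_nonneg hξ.1.le] at h1
  rw [norm_smul, he, mul_one, Real.norm_of_nonneg hε.le] at h2
  have h3 : H * ξ ^ α * ∫ x, |fderiv ℝ w x e| ∂μ ≤ H * ε ^ α * ∫ x, ‖fderiv ℝ w x‖ ∂μ :=
    mul_le_mul (mul_le_mul_of_nonneg_left (Real.rpow_le_rpow hξ.1.le hξ.2.le hα.le) hH) hle
      (integral_nonneg fun _ => abs_nonneg _) (by positivity)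
  have h4 : |∫ x, V x * fderiv ℝ w (x + ξ • e) e ∂μ|
      ≤ H * ε ^ α * (∫ x, |w x| ∂μ) / ε := by
    rw [hslope, abs_div, sub_zero, abs_of_pos hε]
    refine div_le_div_of_nonneg_right ?_ hε.le
    simpa using h2
  have h5 := abs_sub_abs_le_abs_sub (∫ x, V x * fderiv ℝ w x e ∂μ)
    (∫ x, V x * fderiv ℝ w (x + ξ • e) e ∂μ)
  rw [abs_sub_comm] at h1
  linarith

end HolderPairing

/-- For bounded `α`-Hölder `V` with constant `H`, smooth compactly supported `w` and any
coordinate direction `i`: `|∫ V ∂ᵢw| ≤ C H ‖w‖₁^α ‖∇w‖₁^{1−α}`. -/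
theorem stmt_8 (N : ℕ) (hN : 1 ≤ N) (α : ℝ) (hα0 : 0 < α) (hα1 : α ≤ 1) :
    ∃ C > 0, ∀ (V : EuclideanSpace ℝ (Fin N) → ℝ) (H : ℝ),
      (∃ B : ℝ, ∀ x, |V x| ≤ B) →
      (∀ x y, |V x - V y| ≤ H * ‖x - y‖ ^ α) →
      ∀ w : EuclideanSpace ℝ (Fin N) → ℝ, ContDiff ℝ (⊤ : ℕ∞) w → HasCompactSupport w →
        ∀ i : Fin N,
          |∫ x, V x * fderiv ℝ w x (EuclideanSpace.single i 1)|
            ≤ C * H * (∫ x, |w x|) ^ α * (∫ x, ‖fderiv ℝ w x‖) ^ (1 - α) := by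
  refine ⟨2, two_pos, ?_⟩
  rintro V H ⟨B, hB⟩ hV w hw hws i
  have he : ‖(EuclideanSpace.single i 1 : EuclideanSpace ℝ (Fin N))‖ = 1 := by simp
  have hH : 0 ≤ H := by
    simpa [he] using (abs_nonneg _).trans (hV (EuclideanSpace.single i 1) 0)
  have hw1 : ContDiff ℝ 1 w := hw.of_le (by exact_mod_cast le_top)
  have hfc : Continuous (fderiv ℝ w) := hw1.continuous_fderiv one_ne_zero
  have hA0 : 0 ≤ ∫ x, |w x| := integral_nonneg fun _ => abs_nonneg _
  have hD0 : 0 ≤ ∫ x, ‖fderiv ℝ w x‖ := integral_nonneg fun _ => norm_nonneg _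
  by_cases hz : fderiv ℝ w = 0
  · simp only [hz, Pi.zero_apply, zero_apply, mul_zero, integral_zero,
      abs_zero, norm_zero]
    have : (0 : ℝ) ≤ 0 ^ (1 - α) := Real.rpow_nonneg le_rfl _
    positivity
  have hA : 0 < ∫ x, |w x| := by
    refine hA0.lt_of_ne' fun h => hz ?_
    rw [integral_eq_zero_iff_of_nonneg (fun _ => abs_nonneg _)
      (hw1.continuous.integrable_of_hasCompactSupport hws).abs,
      hw1.continuous.abs.ae_eq_iff_eq volume continuous_zero] at h
    have hw0 : w = 0 := funext fun x => abs_eq_zero.mp (congrFun h x)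
    rw [hw0, fderiv_zero]
  have hD : 0 < ∫ x, ‖fderiv ℝ w x‖ := by
    refine hD0.lt_of_ne' fun h => hz ?_
    rw [integral_eq_zero_iff_of_nonneg (fun _ => norm_nonneg _)
      (hfc.integrable_of_hasCompactSupport (hws.fderiv ℝ)).norm,
      hfc.norm.ae_eq_iff_eq volume continuous_zero] at h
    exact funext fun x => norm_eq_zero.mp (congrFun h x)
  refine (abs_integral_mul_fderiv_le hH hα0 hV hB hw1 hws he (div_pos hA hD)).trans_eq ?_
  rw [Real.div_rpow hA0 hD0, Real.rpow_sub hD, Real.rpow_one]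
  have := (Real.rpow_pos_of_pos hD α).ne'
  field_simp
  ring
end

section
/- Let N ≥ 1 be an integer and let 0 < α ≤ β ≤ 1. For a finite signed Borel measure ν on ℝ^N supported in the closed unit ball and for γ ∈ (0,1], define D_γ(ν) := sup{ |∫ Φ dν| : Φ : ℝ^N → ℝ with ‖Φ‖_∞ ≤ 1 and |Φ(x) − Φ(y)| ≤ |x − y|^γ for all x, y }. Then D_β(ν) ≤ 2·D_α(ν), and there exists a constant C > 0, depending only on N, α and β, such that D_α(ν) ≤ C · ‖ν‖^{1−α/β} · D_β(ν)^{α/β}, where ‖ν‖ denotes the total variation norm of ν. -/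
open MeasureTheory

/-- The dual `γ`-Hölder norm of a signed measure `ν` on `ℝ^N`: the supremum of
`|∫ Φ dν|` over test functions `Φ` with `‖Φ‖_∞ ≤ 1` that are `γ`-Hölder with constant `1`.
The integral against `ν` is taken via the Jordan decomposition. -/
noncomputable def dualHolderDist {N : ℕ} (γ : ℝ)
    (ν : MeasureTheory.SignedMeasure (EuclideanSpace ℝ (Fin N))) : ℝ :=
  sSup {r : ℝ | ∃ Φ : EuclideanSpace ℝ (Fin N) → ℝ,
    (∀ x, |Φ x| ≤ 1) ∧ (∀ x y, |Φ x - Φ y| ≤ ‖x - y‖ ^ γ) ∧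
    r = |(∫ x, Φ x ∂ν.toJordanDecomposition.posPart) -
          ∫ x, Φ x ∂ν.toJordanDecomposition.negPart|}

section HolderRegularization

variable {E : Type*} [NormedAddCommGroup E]

theorem continuous_of_abs_sub_le_mul_rpow {γ L : ℝ} (hγ : 0 < γ) {Φ : E → ℝ}
    (h : ∀ x y, |Φ x - Φ y| ≤ L * ‖x - y‖ ^ γ) : Continuous Φ := by
  rw [continuous_iff_continuousAt]
  intro x
  rw [ContinuousAt, tendsto_iff_dist_tendsto_zero]
  have hlim : Filter.Tendsto (fun y : E => L * ‖y - x‖ ^ γ) (nhds x) (nhds 0) := by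
    have hc : Continuous fun y : E => L * ‖y - x‖ ^ γ :=
      continuous_const.mul ((continuous_id.sub continuous_const).norm.rpow_const
        fun _ => Or.inr hγ.le)
    simpa [Real.zero_rpow hγ.ne'] using hc.tendsto x
  exact squeeze_zero (fun _ => dist_nonneg) (fun y => by simpa [Real.dist_eq] using h y x) hlim

/-- The inf-convolution of `Φ` with `L ‖·‖ ^ β`. -/
noncomputable def holderInfConv (L β : ℝ) (Φ : E → ℝ) (x : E) : ℝ :=
  ⨅ y, (Φ y + L * ‖x - y‖ ^ β)

variable {L β : ℝ} {Φ : E → ℝ}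

theorem neg_one_le_add_mul_rpow (hL : 0 ≤ L) (hΦ : ∀ x, |Φ x| ≤ 1) (x y : E) :
    -1 ≤ Φ y + L * ‖x - y‖ ^ β := by
  have h1 := (abs_le.1 (hΦ y)).1
  have h2 : 0 ≤ L * ‖x - y‖ ^ β := by positivity
  linarith

theorem holderInfConv_le_add (hL : 0 ≤ L) (hΦ : ∀ x, |Φ x| ≤ 1) (x y : E) :
    holderInfConv L β Φ x ≤ Φ y + L * ‖x - y‖ ^ β :=
  ciInf_le ⟨-1, by rintro _ ⟨z, rfl⟩; exact neg_one_le_add_mul_rpow hL hΦ x z⟩ y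

theorem holderInfConv_le (hβ : 0 < β) (hL : 0 ≤ L) (hΦ : ∀ x, |Φ x| ≤ 1) (x : E) :
    holderInfConv L β Φ x ≤ Φ x := by
  simpa [Real.zero_rpow hβ.ne'] using holderInfConv_le_add (β := β) hL hΦ x x

theorem abs_holderInfConv_le_one (hβ : 0 < β) (hL : 0 ≤ L) (hΦ : ∀ x, |Φ x| ≤ 1) (x : E) :
    |holderInfConv L β Φ x| ≤ 1 :=
  abs_le.2 ⟨le_ciInf fun y => neg_one_le_add_mul_rpow hL hΦ x y,
    (holderInfConv_le hβ hL hΦ x).trans (abs_le.1 (hΦ x)).2⟩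

theorem norm_sub_rpow_le_add (hβ : 0 < β) (hβ1 : β ≤ 1) (x y z : E) :
    ‖x - z‖ ^ β ≤ ‖x - y‖ ^ β + ‖y - z‖ ^ β :=
  (Real.rpow_le_rpow (norm_nonneg _) (norm_sub_le_norm_sub_add_norm_sub x y z) hβ.le).trans
    (Real.rpow_add_le_add_rpow (norm_nonneg _) (norm_nonneg _) hβ.le hβ1)

theorem abs_holderInfConv_sub_le (hβ : 0 < β) (hβ1 : β ≤ 1) (hL : 0 ≤ L)
    (hΦ : ∀ x, |Φ x| ≤ 1) (x y : E) :
    |holderInfConv L β Φ x - holderInfConv L β Φ y| ≤ L * ‖x - y‖ ^ β := by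
  have key : ∀ x y : E,
      holderInfConv L β Φ x - L * ‖x - y‖ ^ β ≤ holderInfConv L β Φ y := by
    intro x y
    refine le_ciInf fun z => ?_
    have h1 := holderInfConv_le_add (β := β) hL hΦ x z
    have h2 := mul_le_mul_of_nonneg_left (norm_sub_rpow_le_add hβ hβ1 x y z) hL
    linarith
  have h1 := key x y
  have h2 := key y x
  rw [norm_sub_rev] at h2
  exact abs_le.2 ⟨by linarith, by linarith⟩

/-- For `0 ≤ s ≤ 1` and `τ > 0`, the power `u ^ s` is dominated by an affine function of `u`. -/
theorem rpow_le_rpow_add_rpow_sub_one_mul {τ s u : ℝ} (hτ : 0 < τ) (hs : 0 ≤ s) (hs1 : s ≤ 1)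
    (hu : 0 ≤ u) : u ^ s ≤ τ ^ s + τ ^ (s - 1) * u := by
  rcases le_total u τ with h | h
  · exact (Real.rpow_le_rpow hu h hs).trans (le_add_of_nonneg_right (by positivity))
  · have hu' : 0 < u := hτ.trans_le h
    have h1 : u ^ s = u ^ (s - 1) * u := by rw [Real.rpow_sub_one hu'.ne']; field_simp
    rw [h1]
    exact (mul_le_mul_of_nonneg_right
      (Real.rpow_le_rpow_of_nonpos hτ h (by linarith)) hu).trans
      (le_add_of_nonneg_left (by positivity))

theorem abs_sub_holderInfConv_le {α τ : ℝ} (hα : 0 < α) (hαβ : α ≤ β) (hτ : 0 < τ)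
    (hΦ : ∀ x, |Φ x| ≤ 1) (hH : ∀ x y, |Φ x - Φ y| ≤ ‖x - y‖ ^ α) (x : E) :
    |Φ x - holderInfConv (τ ^ (α / β - 1)) β Φ x| ≤ τ ^ (α / β) := by
  have hβ : 0 < β := hα.trans_le hαβ
  have hL : 0 ≤ τ ^ (α / β - 1) := by positivity
  have h1 := holderInfConv_le hβ hL hΦ x
  rw [abs_of_nonneg (by linarith)]
  have h2 : Φ x - τ ^ (α / β) ≤ holderInfConv (τ ^ (α / β - 1)) β Φ x := by
    refine le_ciInf fun y => ?_
    have h3 := (abs_le.1 (hH x y)).2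
    have h4 := rpow_le_rpow_add_rpow_sub_one_mul hτ (div_pos hα hβ).le
      ((div_le_one hβ).2 hαβ) (Real.rpow_nonneg (norm_nonneg (x - y)) β)
    rw [← Real.rpow_mul (norm_nonneg _), mul_div_cancel₀ _ hβ.ne'] at h4
    linarith
  linarith

end HolderRegularization

section JordanIntegral

variable {X : Type*} [MeasurableSpace X]

/-- The integral of a function against a signed measure, via the Jordan decomposition. -/
noncomputable def jordanIntegral (ν : SignedMeasure X) (Φ : X → ℝ) : ℝ :=
  (∫ x, Φ x ∂ν.toJordanDecomposition.posPart) - ∫ x, Φ x ∂ν.toJordanDecomposition.negPart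

theorem abs_jordanIntegral_le (ν : SignedMeasure X) {Φ : X → ℝ} {c : ℝ}
    (h : ∀ x, |Φ x| ≤ c) :
    |jordanIntegral ν Φ| ≤ c * (ν.totalVariation Set.univ).toReal := by
  have hp := norm_integral_le_of_norm_le_const (μ := ν.toJordanDecomposition.posPart) (f := Φ)
    (Filter.Eventually.of_forall h)
  have hn := norm_integral_le_of_norm_le_const (μ := ν.toJordanDecomposition.negPart) (f := Φ)
    (Filter.Eventually.of_forall h)
  have hsum : (ν.totalVariation Set.univ).toReal =
      ν.toJordanDecomposition.posPart.real Set.univ +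
        ν.toJordanDecomposition.negPart.real Set.univ := by
    rw [SignedMeasure.totalVariation, Measure.add_apply,
      ENNReal.toReal_add (measure_ne_top _ _) (measure_ne_top _ _)]
    rfl
  rw [hsum, mul_add]
  exact (abs_sub _ _).trans (add_le_add hp hn)

theorem jordanIntegral_const_mul (ν : SignedMeasure X) (c : ℝ) (Φ : X → ℝ) :
    jordanIntegral ν (fun x => c * Φ x) = c * jordanIntegral ν Φ := by
  simp only [jordanIntegral, integral_const_mul, mul_sub]

theorem jordanIntegral_sub [TopologicalSpace X] [OpensMeasurableSpace X]
    (ν : SignedMeasure X) {Φ Ψ : X → ℝ} {c d : ℝ}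
    (hΦ : Continuous Φ) (hΦc : ∀ x, |Φ x| ≤ c) (hΨ : Continuous Ψ) (hΨd : ∀ x, |Ψ x| ≤ d) :
    jordanIntegral ν (fun x => Φ x - Ψ x) = jordanIntegral ν Φ - jordanIntegral ν Ψ := by
  have hi : ∀ (μ : Measure X) [IsFiniteMeasure μ] {F : X → ℝ} {e : ℝ}, Continuous F →
      (∀ x, |F x| ≤ e) → Integrable F μ := fun μ _ F e hF he =>
    Integrable.of_bound hF.measurable.aestronglyMeasurable e (Filter.Eventually.of_forall he)
  unfold jordanIntegral
  rw [integral_sub (hi _ hΦ hΦc) (hi _ hΨ hΨd), integral_sub (hi _ hΦ hΦc) (hi _ hΨ hΨd)]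
  ring

end JordanIntegral

section DualHolderDist

variable {N : ℕ} {α β γ : ℝ} (ν : SignedMeasure (EuclideanSpace ℝ (Fin N)))

theorem abs_jordanIntegral_le_dualHolderDist {Φ : EuclideanSpace ℝ (Fin N) → ℝ}
    (hΦ : ∀ x, |Φ x| ≤ 1) (hH : ∀ x y, |Φ x - Φ y| ≤ ‖x - y‖ ^ γ) :
    |jordanIntegral ν Φ| ≤ dualHolderDist γ ν := by
  refine le_csSup ⟨(ν.totalVariation Set.univ).toReal, ?_⟩ ⟨Φ, hΦ, hH, rfl⟩
  rintro _ ⟨Ψ, hΨ, -, rfl⟩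
  exact (abs_jordanIntegral_le ν hΨ).trans_eq (one_mul _)

theorem dualHolderDist_le {c : ℝ} (h : ∀ Φ : EuclideanSpace ℝ (Fin N) → ℝ,
    (∀ x, |Φ x| ≤ 1) → (∀ x y, |Φ x - Φ y| ≤ ‖x - y‖ ^ γ) → |jordanIntegral ν Φ| ≤ c) :
    dualHolderDist γ ν ≤ c := by
  refine csSup_le ⟨_, fun _ => 0, by simp, fun x y => by simp; positivity, rfl⟩ ?_
  rintro _ ⟨Φ, hΦ, hH, rfl⟩
  exact h Φ hΦ hH

theorem dualHolderDist_nonneg : 0 ≤ dualHolderDist γ ν :=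
  (abs_nonneg _).trans (abs_jordanIntegral_le_dualHolderDist ν (Φ := fun _ => 0) (by simp)
    fun x y => by simp; positivity)

theorem dualHolderDist_le_totalVariation :
    dualHolderDist γ ν ≤ (ν.totalVariation Set.univ).toReal :=
  dualHolderDist_le ν fun _ hΦ _ => by simpa using abs_jordanIntegral_le ν hΦ

theorem abs_jordanIntegral_le_mul_dualHolderDist {L : ℝ} (hL : 1 ≤ L)
    {Φ : EuclideanSpace ℝ (Fin N) → ℝ} (hΦ : ∀ x, |Φ x| ≤ L)
    (hH : ∀ x y, |Φ x - Φ y| ≤ L * ‖x - y‖ ^ γ) :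
    |jordanIntegral ν Φ| ≤ L * dualHolderDist γ ν := by
  have hL0 : 0 < L := by linarith
  have h := abs_jordanIntegral_le_dualHolderDist (γ := γ) ν (Φ := fun x => L⁻¹ * Φ x)
    (fun x => by
      rw [abs_mul, abs_of_pos (inv_pos.2 hL0), inv_mul_le_iff₀ hL0, mul_one]
      exact hΦ x)
    (fun x y => by
      rw [← mul_sub, abs_mul, abs_of_pos (inv_pos.2 hL0), inv_mul_le_iff₀ hL0]
      exact hH x y)
  rwa [jordanIntegral_const_mul, abs_mul, abs_of_pos (inv_pos.2 hL0),
    inv_mul_le_iff₀ hL0] at h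

theorem dualHolderDist_le_two_mul (hα : 0 < α) (hαβ : α ≤ β) :
    dualHolderDist β ν ≤ 2 * dualHolderDist α ν := by
  refine dualHolderDist_le ν fun Φ hΦ hH =>
    abs_jordanIntegral_le_mul_dualHolderDist ν one_le_two
      (fun x => (hΦ x).trans one_le_two) fun x y => ?_
  rcases le_total ‖x - y‖ 1 with h | h
  · have h1 : ‖x - y‖ ^ β ≤ ‖x - y‖ ^ α :=
      Real.rpow_le_rpow_of_exponent_ge' (norm_nonneg _) h hα.le hαβ
    have h2 : 0 ≤ ‖x - y‖ ^ α := by positivity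
    linarith [hH x y]
  · have h1 : 1 ≤ ‖x - y‖ ^ α := Real.one_le_rpow h hα.le
    linarith [abs_sub (Φ x) (Φ y), hΦ x, hΦ y]

theorem dualHolderDist_le_add {τ : ℝ} (hα : 0 < α) (hαβ : α ≤ β) (hβ : β ≤ 1) (hτ : 0 < τ)
    (hτ1 : τ ≤ 1) :
    dualHolderDist α ν ≤ τ ^ (α / β) * (ν.totalVariation Set.univ).toReal +
      τ ^ (α / β - 1) * dualHolderDist β ν := by
  have hβ0 : 0 < β := hα.trans_le hαβ
  have hL : 1 ≤ τ ^ (α / β - 1) := Real.one_le_rpow_of_pos_of_le_one_of_nonpos hτ hτ1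
    (sub_nonpos.2 ((div_le_one hβ0).2 hαβ))
  have hL0 : 0 ≤ τ ^ (α / β - 1) := by positivity
  refine dualHolderDist_le ν fun Φ hΦ hH => ?_
  have hΨ1 := abs_holderInfConv_le_one hβ0 hL0 hΦ
  have hΨ := abs_holderInfConv_sub_le hβ0 hβ hL0 hΦ
  have h1 := abs_jordanIntegral_le ν (abs_sub_holderInfConv_le hα hαβ hτ hΦ hH)
  rw [jordanIntegral_sub ν
    (continuous_of_abs_sub_le_mul_rpow (L := 1) hα (by simpa using hH)) hΦ
    (continuous_of_abs_sub_le_mul_rpow hβ0 hΨ) hΨ1] at h1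
  have h2 := abs_jordanIntegral_le_mul_dualHolderDist ν hL (fun x => (hΨ1 x).trans hL) hΨ
  have h3 := abs_sub_abs_le_abs_sub (jordanIntegral ν Φ)
    (jordanIntegral ν (holderInfConv (τ ^ (α / β - 1)) β Φ))
  linarith

theorem dualHolderDist_le_interpolation (hα : 0 < α) (hαβ : α ≤ β) (hβ : β ≤ 1) :
    dualHolderDist α ν ≤ 2 * (ν.totalVariation Set.univ).toReal ^ (1 - α / β) *
      dualHolderDist β ν ^ (α / β) := by
  have hs : 0 < α / β := div_pos hα (hα.trans_le hαβ)
  have hD := dualHolderDist_nonneg (γ := β) ν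
  have hDM := dualHolderDist_le_totalVariation (γ := β) ν
  have key := fun τ h0 h1 => dualHolderDist_le_add (τ := τ) ν hα hαβ hβ h0 h1
  set M := (ν.totalVariation Set.univ).toReal
  set D := dualHolderDist β ν
  set s := α / β
  rcases hD.eq_or_lt with h0 | h0
  · rw [← h0] at key ⊢
    rw [Real.zero_rpow hs.ne', mul_zero]
    have hlim : Filter.Tendsto (fun τ : ℝ => τ ^ s * M) (nhdsWithin 0 (Set.Ioi 0)) (nhds 0) := by
      have hc : Continuous fun τ : ℝ => τ ^ s * M :=
        (Real.continuous_rpow_const hs.le).mul continuous_const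
      simpa [Real.zero_rpow hs.ne'] using (hc.tendsto 0).mono_left nhdsWithin_le_nhds
    refine ge_of_tendsto hlim ?_
    filter_upwards [Ioc_mem_nhdsGT (zero_lt_one' ℝ)] with τ hτ
    simpa using key τ hτ.1 hτ.2
  · have hM : 0 < M := h0.trans_le hDM
    refine (key (D / M) (div_pos h0 hM) ((div_le_one hM).2 hDM)).trans_eq ?_
    rw [Real.rpow_sub_one (div_pos h0 hM).ne', Real.div_rpow h0.le hM.le, Real.rpow_sub hM,
      Real.rpow_one]
    field_simp
    norm_num

end DualHolderDist

/-- Interpolation between dual Hölder norms of signed measures supported in the closed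
unit ball: `D_β(ν) ≤ 2 D_α(ν)` and `D_α(ν) ≤ C ‖ν‖^{1−α/β} D_β(ν)^{α/β}`. -/
theorem stmt_9 (N : ℕ) (hN : 1 ≤ N) (α β : ℝ) (hα : 0 < α) (hαβ : α ≤ β) (hβ : β ≤ 1) :
    ∃ C > 0, ∀ ν : MeasureTheory.SignedMeasure (EuclideanSpace ℝ (Fin N)),
      (∀ A : Set (EuclideanSpace ℝ (Fin N)), MeasurableSet A →
        A ∩ Metric.closedBall 0 1 = ∅ → ν A = 0) →
      dualHolderDist β ν ≤ 2 * dualHolderDist α ν ∧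
      dualHolderDist α ν
        ≤ C * (ν.totalVariation Set.univ).toReal ^ (1 - α / β) *
            dualHolderDist β ν ^ (α / β) := by
  exact ⟨2, two_pos, fun ν _ =>
    ⟨dualHolderDist_le_two_mul ν hα hαβ, dualHolderDist_le_interpolation ν hα hαβ hβ⟩⟩
end

section
/- Let N ≥ 2 be an integer, 0 < α ≤ 1, and c, C > 0. Let μ be a finite positive Borel measure on ℝ^N supported in the closed unit ball B̄ such that μ(B(x, r)) ≤ c·r^{N−2+α} for every x ∈ ℝ^N and every r > 0. Let H : B̄ × B̄ → ℝ be continuous off the diagonal, with x ↦ H(x, y) differentiable on {x ≠ y} for each y, and suppose |H(x, y)| ≤ C·(1 + |log|x − y||)·|x − y|^{2−N} and |∇_x H(x, y)| ≤ C·|x − y|^{1−N} for all x ≠ y. Then the function Θ(x) := ∫_{B̄} H(x, y) dμ(y) is well-defined and finite for every x ∈ B̄, and for every real α' with 0 < α' < α/N there is a constant C' > 0, depending only on N, α, α', c and C, such that |Θ(x) − Θ(x')| ≤ C'·|x − x'|^{α'} for all x, x' ∈ B̄; in particular Θ is Hölder continuous on B̄ with every exponent α' < α/N. -/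
open MeasureTheory

/-- A growth bound `μ(B(x,r)) ≤ c r^d` controls the potential `∫ dist x y ^ (-a)` on balls for every
`0 < a < d`: sum over the dyadic balls `B(x, r 2^{-k})`. -/
theorem lintegral_ball_dist_rpow_neg_le {X : Type*} [PseudoMetricSpace X] [MeasurableSpace X]
    [OpensMeasurableSpace X] {μ : Measure X} {c d a : ℝ} (hc : 0 ≤ c) (ha : 0 < a) (had : a < d)
    (hμ : ∀ (x : X) (r : ℝ), 0 < r → μ (Metric.ball x r) ≤ ENNReal.ofReal (c * r ^ d))
    (x : X) {r : ℝ} (hr : 0 < r) :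
    ∫⁻ y in Metric.ball x r, ENNReal.ofReal (dist x y ^ (-a)) ∂μ ≤
      ENNReal.ofReal (c * 2 ^ a * (1 - (1 / 2) ^ (d - a))⁻¹ * r ^ (d - a)) := by
  set q : ℝ := (1 / 2) ^ (d - a) with hq
  have hq0 : 0 ≤ q := by positivity
  have hq1 : q < 1 := Real.rpow_lt_one (by norm_num) (by norm_num) (by linarith)
  have hpt : ∀ y, (Metric.ball x r).indicator (fun y => ENNReal.ofReal (dist x y ^ (-a))) y ≤
      ∑' k : ℕ, (Metric.ball x (r * (1 / 2) ^ k)).indicator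
        (fun _ => ENNReal.ofReal ((r * (1 / 2) ^ (k + 1)) ^ (-a))) y := by
    intro y
    by_cases hy : y ∈ Metric.ball x r
    · rw [Set.indicator_of_mem hy]
      rcases eq_or_lt_of_le (dist_nonneg (x := x) (y := y)) with h0 | h0
      · rw [← h0, Real.zero_rpow (by linarith)]
        simp
      · rw [Metric.mem_ball, dist_comm] at hy
        obtain ⟨k, hk1, hk2⟩ := exists_nat_pow_near_of_lt_one (div_pos h0 hr)
          ((div_le_one hr).2 hy.le) (by norm_num : (0 : ℝ) < 1 / 2) (by norm_num)
        rw [lt_div_iff₀' hr] at hk1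
        rw [div_le_iff₀' hr] at hk2
        rcases hk2.lt_or_eq with hk2 | hk2
        · refine le_trans ?_ (ENNReal.le_tsum k)
          rw [Set.indicator_of_mem (by rwa [Metric.mem_ball, dist_comm])]
          exact ENNReal.ofReal_le_ofReal
            (Real.rpow_le_rpow_of_nonpos (by positivity) hk1.le (by linarith))
        · have hk : k ≠ 0 := by
            rintro rfl
            rw [pow_zero, mul_one] at hk2
            exact hy.ne hk2
          obtain ⟨j, rfl⟩ := Nat.exists_eq_succ_of_ne_zero hk
          refine le_trans ?_ (ENNReal.le_tsum j)
          rw [Set.indicator_of_mem]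
          · rw [hk2]
          · rw [Metric.mem_ball, dist_comm, hk2]
            have := pow_lt_pow_right_of_lt_one₀ (by norm_num : (0 : ℝ) < 1 / 2) (by norm_num)
              (Nat.lt_succ_self j)
            gcongr
    · rw [Set.indicator_of_notMem hy]
      exact zero_le
  have hterm : ∀ k : ℕ, ENNReal.ofReal ((r * (1 / 2) ^ (k + 1)) ^ (-a)) *
      μ (Metric.ball x (r * (1 / 2) ^ k)) ≤
        ENNReal.ofReal (c * 2 ^ a * r ^ (d - a) * q ^ k) := by
    intro k
    have hk : (0 : ℝ) < (1 / 2) ^ k := by positivity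
    refine (mul_le_mul_right (hμ x _ (by positivity)) _).trans ?_
    rw [← ENNReal.ofReal_mul (by positivity)]
    refine ENNReal.ofReal_le_ofReal (le_of_eq ?_)
    have e1 : q ^ k = ((1 / 2 : ℝ) ^ k) ^ (d - a) := by
      rw [hq, ← Real.rpow_natCast, ← Real.rpow_natCast, ← Real.rpow_mul (by norm_num),
        ← Real.rpow_mul (by norm_num), mul_comm]
    have e2 : r * (1 / 2 : ℝ) ^ (k + 1) = (r * (1 / 2) ^ k) * 2⁻¹ := by ring
    rw [e1, e2, Real.mul_rpow (by positivity) (by norm_num), Real.inv_rpow (by norm_num),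
      Real.rpow_neg (by norm_num : (0 : ℝ) ≤ 2) a, inv_inv, mul_assoc (c * 2 ^ a),
      ← Real.mul_rpow hr.le hk.le, sub_eq_neg_add, Real.rpow_add (by positivity)]
    ring
  calc ∫⁻ y in Metric.ball x r, ENNReal.ofReal (dist x y ^ (-a)) ∂μ
      = ∫⁻ y, (Metric.ball x r).indicator (fun y => ENNReal.ofReal (dist x y ^ (-a))) y ∂μ :=
        (lintegral_indicator Metric.isOpen_ball.measurableSet _).symm
    _ ≤ ∫⁻ y, ∑' k : ℕ, (Metric.ball x (r * (1 / 2) ^ k)).indicator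
        (fun _ => ENNReal.ofReal ((r * (1 / 2) ^ (k + 1)) ^ (-a))) y ∂μ := lintegral_mono hpt
    _ = ∑' k : ℕ, ENNReal.ofReal ((r * (1 / 2) ^ (k + 1)) ^ (-a)) *
          μ (Metric.ball x (r * (1 / 2) ^ k)) := by
        rw [lintegral_tsum fun k =>
          (measurable_const.indicator Metric.isOpen_ball.measurableSet).aemeasurable]
        simp_rw [lintegral_indicator_const Metric.isOpen_ball.measurableSet]
    _ ≤ ∑' k : ℕ, ENNReal.ofReal (c * 2 ^ a * r ^ (d - a) * q ^ k) := ENNReal.tsum_le_tsum hterm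
    _ = ENNReal.ofReal (c * 2 ^ a * (1 - q)⁻¹ * r ^ (d - a)) := by
        rw [← ENNReal.ofReal_tsum_of_nonneg (fun k => by positivity)
          ((summable_geometric_of_lt_one hq0 hq1).mul_left _), tsum_mul_left,
          tsum_geometric_of_lt_one hq0 hq1]
        ring_nf

theorem integrableOn_ball_dist_rpow_neg {X : Type*} [PseudoMetricSpace X] [MeasurableSpace X]
    [OpensMeasurableSpace X] {μ : Measure X} {c d a : ℝ} (hc : 0 ≤ c) (ha : 0 < a) (had : a < d)
    (hμ : ∀ (x : X) (r : ℝ), 0 < r → μ (Metric.ball x r) ≤ ENNReal.ofReal (c * r ^ d))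
    (x : X) {r : ℝ} (hr : 0 < r) :
    IntegrableOn (fun y => dist x y ^ (-a)) (Metric.ball x r) μ := by
  have hm : Measurable fun y => dist x y := (continuous_const.dist continuous_id).measurable
  refine ⟨(hm.pow_const _).aestronglyMeasurable, ?_⟩
  rw [hasFiniteIntegral_iff_ofReal (.of_forall fun y => by positivity)]
  exact (lintegral_ball_dist_rpow_neg_le hc ha had hμ x hr).trans_lt ENNReal.ofReal_lt_top

theorem setIntegral_ball_dist_rpow_neg_le {X : Type*} [PseudoMetricSpace X] [MeasurableSpace X]
    [OpensMeasurableSpace X] {μ : Measure X} {c d a : ℝ} (hc : 0 ≤ c) (ha : 0 < a) (had : a < d)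
    (hμ : ∀ (x : X) (r : ℝ), 0 < r → μ (Metric.ball x r) ≤ ENNReal.ofReal (c * r ^ d))
    (x : X) {r : ℝ} (hr : 0 < r) :
    ∫ y in Metric.ball x r, dist x y ^ (-a) ∂μ ≤
      c * 2 ^ a * (1 - (1 / 2) ^ (d - a))⁻¹ * r ^ (d - a) := by
  have hq1 : (1 / 2 : ℝ) ^ (d - a) < 1 :=
    Real.rpow_lt_one (by norm_num) (by norm_num) (by linarith)
  have hq2 : 0 < 1 - (1 / 2 : ℝ) ^ (d - a) := by linarith
  rw [integral_eq_lintegral_of_nonneg_ae (.of_forall fun y => by positivity)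
    (integrableOn_ball_dist_rpow_neg hc ha had hμ x hr).aestronglyMeasurable]
  exact ENNReal.toReal_le_of_le_ofReal (by positivity)
    (lintegral_ball_dist_rpow_neg_le hc ha had hμ x hr)

theorem measure_singleton_eq_zero_of_ball_le {X : Type*} [PseudoMetricSpace X] [MeasurableSpace X]
    {μ : Measure X} {c d : ℝ} (hd : 0 < d)
    (hμ : ∀ (x : X) (r : ℝ), 0 < r → μ (Metric.ball x r) ≤ ENNReal.ofReal (c * r ^ d)) (x : X) :
    μ {x} = 0 := by
  have hlim : Filter.Tendsto (fun r : ℝ => ENNReal.ofReal (c * r ^ d))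
      (nhdsWithin 0 (Set.Ioi 0)) (nhds 0) := by
    have h : Filter.Tendsto (fun r : ℝ => c * r ^ d) (nhds 0) (nhds (c * 0 ^ d)) :=
      ((Real.continuousAt_rpow_const 0 d (.inr hd.le)).const_mul c).tendsto
    rw [Real.zero_rpow hd.ne', mul_zero] at h
    simpa using ENNReal.tendsto_ofReal (h.mono_left nhdsWithin_le_nhds)
  refine le_antisymm (ge_of_tendsto hlim ?_) zero_le
  filter_upwards [self_mem_nhdsWithin] with r hr
  exact (measure_mono (Set.singleton_subset_iff.2 (Metric.mem_ball_self hr))).trans (hμ x r hr)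

theorem one_add_abs_log_le_rpow_neg {η t : ℝ} (hη : 0 < η) (ht : 0 < t) (ht2 : t ≤ 2) :
    1 + |Real.log t| ≤ (2 ^ η + (4 ^ η + 1) / η) * t ^ (-η) := by
  have hp : 0 < t ^ η := by positivity
  have hle : t ^ η ≤ 2 ^ η := Real.rpow_le_rpow ht.le ht2 hη.le
  have hmul : t ^ η * t ^ (-η) = 1 := by rw [← Real.rpow_add ht]; simp
  have hn : 0 < t ^ (-η) := by positivity
  have h1 : 1 ≤ 2 ^ η * t ^ (-η) := by rw [← hmul]; gcongr
  have h2 : t ^ η ≤ 4 ^ η * t ^ (-η) := by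
    have h4 : (4 : ℝ) ^ η = 2 ^ η * 2 ^ η := by
      rw [← Real.mul_rpow (by norm_num) (by norm_num)]; norm_num
    rw [h4, mul_assoc]
    nlinarith [Real.rpow_pos_of_pos (two_pos : (0 : ℝ) < 2) η]
  have hlog1 : Real.log t ≤ t ^ η / η := Real.log_le_rpow_div ht.le hη
  have hlog2 : -Real.log t ≤ t ^ (-η) / η := by
    have := Real.log_le_rpow_div (inv_pos.2 ht).le hη
    rwa [Real.log_inv, Real.inv_rpow ht.le, ← Real.rpow_neg ht.le] at this
  have hlog : |Real.log t| ≤ (t ^ η + t ^ (-η)) / η := by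
    rw [add_div, abs_le]
    have := div_pos hp hη
    have := div_pos hn hη
    constructor <;> linarith
  calc 1 + |Real.log t| ≤ 2 ^ η * t ^ (-η) + (4 ^ η * t ^ (-η) + t ^ (-η)) / η := by
        refine add_le_add h1 (hlog.trans ?_)
        gcongr
    _ = _ := by ring

/-- A function whose gradient is `O(|z - y|^{-b})` off `y` varies by at most `C r^{-b} |x - x'|`
along a segment that stays at distance `r` from `y`. -/
theorem abs_sub_le_of_norm_fderivWithin_le_rpow {E : Type*} [NormedAddCommGroup E]
    [NormedSpace ℝ E] {s : Set E} (hs : Convex ℝ s) {f : E → ℝ} {y : E} {C b r : ℝ} (hC : 0 ≤ C)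
    (hb : b ≤ 0) (hr : 0 < r) (hf : DifferentiableOn ℝ f (s \ {y}))
    (hf' : ∀ x ∈ s, x ≠ y → ‖fderivWithin ℝ f (s \ {y}) x‖ ≤ C * ‖x - y‖ ^ b) {x x' : E}
    (hx : x ∈ s) (hx' : x' ∈ s) (hfar : r + ‖x - x'‖ ≤ ‖x - y‖) :
    |f x - f x'| ≤ C * r ^ b * ‖x - x'‖ := by
  have hseg : ∀ z ∈ segment ℝ x x', r ≤ ‖z - y‖ := by
    intro z hz
    have h1 : ‖x - z‖ ≤ ‖x - x'‖ := by
      have := norm_sub_le_of_mem_segment hz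
      rw [norm_sub_rev x z]
      rwa [norm_sub_rev x x']
    have h2 := norm_sub_le_norm_sub_add_norm_sub x z y
    linarith
  have hne : ∀ z ∈ segment ℝ x x', z ≠ y := by
    rintro z hz rfl
    have := hseg z hz
    rw [sub_self, norm_zero] at this
    linarith
  have hsub : segment ℝ x x' ⊆ s \ {y} := fun z hz => ⟨hs.segment_subset hx hx' hz, hne z hz⟩
  rw [abs_sub_comm, ← Real.norm_eq_abs, norm_sub_rev x x']
  refine (convex_segment x x').norm_image_sub_le_of_norm_hasFDerivWithin_le
    (fun z hz => (hf z (hsub hz)).hasFDerivWithinAt.mono hsub) (fun z hz => ?_)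
    (left_mem_segment ℝ x x') (right_mem_segment ℝ x x')
  refine (hf' z (hsub hz).1 (hsub hz).2).trans ?_
  gcongr ?_ * ?_
  exact Real.rpow_le_rpow_of_nonpos hr (hseg z hz) hb

/-- If `μ` is a finite measure supported in the closed unit ball of `ℝ^N` with
`μ(B(x,r)) ≤ c r^{N−2+α}`, and `H(x,y)` is a kernel, continuous off the diagonal and
differentiable in `x`, with `|H(x,y)| ≤ C(1+|log|x−y||)|x−y|^{2−N}` and
`|∇ₓH(x,y)| ≤ C|x−y|^{1−N}`, then `Θ(x) = ∫ H(x,y) dμ(y)` is well defined and Hölder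
continuous on the closed unit ball with any exponent `α' < α/N`, with a constant
depending only on `N, α, α', c, C`. -/
theorem stmt_11 (N : ℕ) (hN : 2 ≤ N) (α c C : ℝ) (hα0 : 0 < α) (hα1 : α ≤ 1)
    (hc : 0 < c) (hC : 0 < C) (α' : ℝ) (hα'0 : 0 < α') (hα' : α' < α / N) :
    ∃ C' > 0, ∀ μ : Measure (EuclideanSpace ℝ (Fin N)), IsFiniteMeasure μ →
      μ (Metric.closedBall (0 : EuclideanSpace ℝ (Fin N)) 1)ᶜ = 0 →
      (∀ (x : EuclideanSpace ℝ (Fin N)) (r : ℝ), 0 < r →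
        μ (Metric.ball x r) ≤ ENNReal.ofReal (c * r ^ ((N : ℝ) - 2 + α))) →
      ∀ H : EuclideanSpace ℝ (Fin N) → EuclideanSpace ℝ (Fin N) → ℝ,
        ContinuousOn (fun p : EuclideanSpace ℝ (Fin N) × EuclideanSpace ℝ (Fin N) =>
            H p.1 p.2)
          {p | p.1 ∈ Metric.closedBall 0 1 ∧ p.2 ∈ Metric.closedBall 0 1 ∧ p.1 ≠ p.2} →
        (∀ y ∈ Metric.closedBall (0 : EuclideanSpace ℝ (Fin N)) 1,
          DifferentiableOn ℝ (fun x => H x y) (Metric.closedBall 0 1 \ {y})) →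
        (∀ x ∈ Metric.closedBall (0 : EuclideanSpace ℝ (Fin N)) 1,
          ∀ y ∈ Metric.closedBall (0 : EuclideanSpace ℝ (Fin N)) 1, x ≠ y →
            |H x y| ≤ C * (1 + |Real.log ‖x - y‖|) * ‖x - y‖ ^ ((2 : ℝ) - N)) →
        (∀ y ∈ Metric.closedBall (0 : EuclideanSpace ℝ (Fin N)) 1,
          ∀ x ∈ Metric.closedBall (0 : EuclideanSpace ℝ (Fin N)) 1, x ≠ y →
            ‖fderivWithin ℝ (fun z => H z y) (Metric.closedBall 0 1 \ {y}) x‖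
              ≤ C * ‖x - y‖ ^ ((1 : ℝ) - N)) →
        (∀ x ∈ Metric.closedBall (0 : EuclideanSpace ℝ (Fin N)) 1,
          IntegrableOn (fun y => H x y) (Metric.closedBall 0 1) μ) ∧
        ∀ x ∈ Metric.closedBall (0 : EuclideanSpace ℝ (Fin N)) 1,
          ∀ x' ∈ Metric.closedBall (0 : EuclideanSpace ℝ (Fin N)) 1,
            |(∫ y in Metric.closedBall 0 1, H x y ∂μ) -
                ∫ y in Metric.closedBall 0 1, H x' y ∂μ|
              ≤ C' * ‖x - x'‖ ^ α' := by
  have hN0 : (0 : ℝ) < N := by positivity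
  have hN2 : (2 : ℝ) ≤ N := by exact_mod_cast hN
  have hNα : N * α' < α := by rwa [lt_div_iff₀' hN0] at hα'
  have hs0 : 0 < N * α' := by positivity
  have hα'1 : N * α' < 1 := by linarith
  set s : ℝ := N * α' with hs
  set η : ℝ := α - s with hη
  set a : ℝ := (N : ℝ) - 2 + η with ha
  set d : ℝ := (N : ℝ) - 2 + α with hd
  have hη0 : 0 < η := by linarith
  have ha0 : 0 < a := by linarith
  have had : a < d := by linarith
  have hds : d - a = s := by rw [hd, ha, hη]; ring
  set A : ℝ := C * (2 ^ η + (4 ^ η + 1) / η) with hA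
  set K : ℝ := c * 2 ^ a * (1 - (1 / 2) ^ s)⁻¹ with hK
  have hA0 : 0 < A := by positivity
  have hK0 : 0 < K := by
    have : (1 / 2 : ℝ) ^ s < 1 := Real.rpow_lt_one (by norm_num) (by norm_num) hs0
    have : 0 < 1 - (1 / 2 : ℝ) ^ s := by linarith
    positivity
  refine ⟨A * K * 2 ^ s + A * K * 4 ^ s + C * (c * 2 ^ d) + 2 * (A * K * 3 ^ s), by positivity, ?_⟩
  intro μ hfin _ hμ H hcont hdiff hsize hgrad
  set B : Set (EuclideanSpace ℝ (Fin N)) := Metric.closedBall 0 1 with hB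
  have hBm : MeasurableSet B := Metric.isClosed_closedBall.measurableSet
  have hdist2 : ∀ x ∈ B, ∀ y ∈ B, dist x y ≤ 2 := fun x hx y hy => by
    have := dist_triangle_right x y 0
    rw [hB, Metric.mem_closedBall] at hx hy
    linarith
  have hae : ∀ x, ∀ᵐ y ∂μ.restrict B, y ∈ B ∧ x ≠ y := fun x => by
    refine (ae_restrict_mem hBm).and (ae_restrict_of_ae ?_)
    have h := measure_singleton_eq_zero_of_ball_le (by linarith) hμ x
    filter_upwards [measure_eq_zero_iff_ae_notMem.1 h] with y hy hxy
    exact hy hxy.symm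
  -- the potential of `μ` localised to a ball
  let φ (x : EuclideanSpace ℝ (Fin N)) (R : ℝ) : EuclideanSpace ℝ (Fin N) → ℝ :=
    (Metric.ball x R).indicator fun y => dist x y ^ (-a)
  have hφ0 : ∀ x R y, 0 ≤ φ x R y := fun x R y =>
    Set.indicator_nonneg (fun y _ => by positivity) y
  have hφi : ∀ x R, 0 < R → Integrable (φ x R) μ := fun x R hR =>
    (integrableOn_ball_dist_rpow_neg hc.le ha0 had hμ x hR).integrable_indicator
      Metric.isOpen_ball.measurableSet
  have hφK : ∀ x R, 0 < R → ∫ y in B, φ x R y ∂μ ≤ K * R ^ s := fun x R hR => by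
    refine (integral_mono_measure Measure.restrict_le_self
      (.of_forall (hφ0 x R)) (hφi x R hR)).trans ?_
    rw [integral_indicator Metric.isOpen_ball.measurableSet, hK, ← hds]
    exact setIntegral_ball_dist_rpow_neg_le hc.le ha0 had hμ x hR
  have hHφ : ∀ x ∈ B, ∀ y ∈ B, x ≠ y → ∀ R, dist x y < R → |H x y| ≤ A * φ x R y := by
    intro x hx y hy hxy R hR
    have hpos : 0 < dist x y := dist_pos.2 hxy
    have hmem : y ∈ Metric.ball x R := by rwa [Metric.mem_ball']
    simp only [φ]
    rw [Set.indicator_of_mem hmem]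
    refine (hsize x hx y hy hxy).trans ?_
    rw [← dist_eq_norm]
    calc C * (1 + |Real.log (dist x y)|) * dist x y ^ ((2 : ℝ) - N)
        ≤ C * ((2 ^ η + (4 ^ η + 1) / η) * dist x y ^ (-η)) * dist x y ^ ((2 : ℝ) - N) := by
          gcongr
          exact one_add_abs_log_le_rpow_neg hη0 hpos (hdist2 x hx y hy)
      _ = A * dist x y ^ (-a) := by
          rw [show -a = -η + (2 - N) by rw [ha]; ring, Real.rpow_add hpos, hA]
          ring
  have hHφ3 : ∀ x ∈ B, ∀ᵐ y ∂μ.restrict B, ‖H x y‖ ≤ A * φ x 3 y := fun x hx => by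
    filter_upwards [hae x] with y hy
    exact hHφ x hx y hy.1 hy.2 3 (by linarith [hdist2 x hx y hy.1])
  have hint : ∀ x ∈ B, IntegrableOn (fun y => H x y) B μ := by
    intro x hx
    refine Integrable.mono' ((hφi x 3 (by norm_num)).const_mul A).restrict ?_ (hHφ3 x hx)
    have hcx : ContinuousOn (fun y => H x y) (B \ {x}) :=
      hcont.comp (f := fun y => (x, y)) (by fun_prop) fun y hy => ⟨hx, hy.1, Ne.symm hy.2⟩
    have hBx : (B \ {x} : Set _) =ᵐ[μ] B :=
      sdiff_null_ae_eq_self (measure_singleton_eq_zero_of_ball_le (by linarith) hμ x)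
    rw [← Measure.restrict_congr_set hBx]
    exact hcx.aestronglyMeasurable (hBm.diff (measurableSet_singleton x))
  have hbound : ∀ x ∈ B, |∫ y in B, H x y ∂μ| ≤ A * K * 3 ^ s := fun x hx => by
    refine (norm_integral_le_of_norm_le ((hφi x 3 (by norm_num)).const_mul A).restrict
      (hHφ3 x hx)).trans ?_
    rw [integral_const_mul, mul_assoc A]
    exact mul_le_mul_of_nonneg_left (hφK x 3 (by norm_num)) hA0.le
  refine ⟨hint, fun x hx x' hx' => ?_⟩
  rcases eq_or_ne x x' with rfl | hne
  · rw [sub_self, abs_zero]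
    positivity
  have hδ : 0 < ‖x - x'‖ := norm_sub_pos_iff.2 hne
  set δ := ‖x - x'‖ with hδdef
  rcases lt_or_ge 1 δ with h1 | h1
  · have hδ1 : 1 ≤ δ ^ α' := Real.one_le_rpow h1.le hα'0.le
    have hpos : 0 ≤ A * K * 2 ^ s + A * K * 4 ^ s + C * (c * 2 ^ d) := by positivity
    calc _ ≤ |∫ y in B, H x y ∂μ| + |∫ y in B, H x' y ∂μ| := abs_sub _ _
      _ ≤ (A * K * 2 ^ s + A * K * 4 ^ s + C * (c * 2 ^ d) + 2 * (A * K * 3 ^ s)) * 1 := by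
        linarith [hbound x hx, hbound x' hx']
      _ ≤ _ := mul_le_mul_of_nonneg_left hδ1 (by positivity)
  -- the radius of the near-diagonal region is `2 * r`
  set r : ℝ := δ ^ (1 / N : ℝ) with hr
  have hr0 : 0 < r := by positivity
  have hrN : r ^ (N : ℝ) = δ := by
    rw [hr, ← Real.rpow_mul hδ.le, one_div_mul_cancel hN0.ne', Real.rpow_one]
  have hrs : r ^ s = δ ^ α' := by rw [hs, Real.rpow_mul hr0.le, hrN]
  have hδr : δ ≤ r := Real.self_le_rpow_of_le_one hδ.le h1 (by
    rw [div_le_one hN0]; linarith)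
  have hrα : r ≤ δ ^ α' := Real.rpow_le_rpow_of_exponent_ge hδ h1 (by
    rw [le_div_iff₀' hN0]; exact hα'1.le)
  have hBμ : μ.real B ≤ c * 2 ^ d := by
    refine ENNReal.toReal_le_of_le_ofReal (by positivity) ((measure_mono ?_).trans
      (hμ 0 2 (by norm_num)))
    exact Metric.closedBall_subset_ball (by norm_num)
  have hpt : ∀ᵐ y ∂μ.restrict B,
      ‖H x y - H x' y‖ ≤ A * φ x (2 * r) y + A * φ x' (4 * r) y + C * r := by
    filter_upwards [hae x, hae x'] with y hy hy'
    have hφx := mul_nonneg hA0.le (hφ0 x (2 * r) y)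
    have hφx' := mul_nonneg hA0.le (hφ0 x' (4 * r) y)
    have hCr : 0 < C * r := by positivity
    rw [Real.norm_eq_abs]
    rcases lt_or_ge (dist x y) (2 * r) with hnear | hfar
    · have htri : dist x' y < 4 * r := by
        have := dist_triangle_left x' y x
        rw [dist_eq_norm x x'] at this
        linarith
      linarith [abs_sub (H x y) (H x' y), hHφ x hx y hy.1 hy.2 _ hnear,
        hHφ x' hx' y hy'.1 hy'.2 _ htri]
    · have hmv := abs_sub_le_of_norm_fderivWithin_le_rpow (convex_closedBall _ _) hC.le
        (by linarith : (1 : ℝ) - N ≤ 0) hr0 (hdiff y hy.1) (hgrad y hy.1) hx hx'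
        (by rw [← dist_eq_norm x y]; linarith)
      have heq : C * r ^ ((1 : ℝ) - N) * ‖x - x'‖ = C * r := by
        rw [← hδdef, mul_assoc, ← hrN, ← Real.rpow_add hr0, sub_add_cancel, Real.rpow_one]
      linarith
  have hφ1 := (((hφi x (2 * r) (by positivity)).const_mul A).restrict (s := B))
  have hφ2 := (((hφi x' (4 * r) (by positivity)).const_mul A).restrict (s := B))
  have hφ12 : Integrable (fun y => A * φ x (2 * r) y + A * φ x' (4 * r) y) (μ.restrict B) :=
    hφ1.add hφ2
  calc |(∫ y in B, H x y ∂μ) - ∫ y in B, H x' y ∂μ|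
      = ‖∫ y in B, (H x y - H x' y) ∂μ‖ := by
        rw [integral_sub (hint x hx) (hint x' hx'), Real.norm_eq_abs]
    _ ≤ ∫ y in B, (A * φ x (2 * r) y + A * φ x' (4 * r) y + C * r) ∂μ :=
        norm_integral_le_of_norm_le (hφ12.add (integrable_const _)) hpt
    _ = A * (∫ y in B, φ x (2 * r) y ∂μ) + A * (∫ y in B, φ x' (4 * r) y ∂μ)
          + μ.real B * (C * r) := by
        rw [integral_add hφ12 (integrable_const _), integral_add hφ1 hφ2,
          integral_const_mul, integral_const_mul, setIntegral_const, smul_eq_mul]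
    _ ≤ A * (K * (2 * r) ^ s) + A * (K * (4 * r) ^ s) + c * 2 ^ d * (C * δ ^ α') := by
        refine add_le_add (add_le_add ?_ ?_) ?_
        · exact mul_le_mul_of_nonneg_left (hφK _ _ (by positivity)) hA0.le
        · exact mul_le_mul_of_nonneg_left (hφK _ _ (by positivity)) hA0.le
        · gcongr
    _ = (A * K * 2 ^ s + A * K * 4 ^ s + C * (c * 2 ^ d)) * δ ^ α' := by
        rw [Real.mul_rpow (by norm_num) hr0.le, Real.mul_rpow (by norm_num) hr0.le, hrs]
        ring
    _ ≤ _ := by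
        refine mul_le_mul_of_nonneg_right ?_ (by positivity)
        exact le_add_of_nonneg_right (by positivity)
end

section
/- Let N ≥ 3 be an integer and let ν be a finite signed Borel measure on ℝ^N supported in the closed unit ball. Define v(x) := ∫ |x − y|^{2−N} dν(y). Then v is well-defined for Lebesgue-almost every x and is integrable on the ball B(0, 2), and there is a constant C > 0 depending only on N such that ∫_{B(0,2)} |v(x)| dx ≤ C · sup{ |∫ Ψ dν| : Ψ ∈ C¹(ℝ^N) with ‖Ψ‖_∞ ≤ 1 and ‖∇Ψ‖_∞ ≤ 1 }. -/
open MeasureTheory Set Filter Topology Metric Module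

section RieszPotential

variable {E : Type*} [NormedAddCommGroup E]

lemma norm_sq_add_rpow_le (p : ℝ) (hp : 0 ≤ p) {ε : ℝ} (hε : 0 < ε) {z : E} (hz : z ≠ 0) :
    (‖z‖ ^ 2 + ε) ^ (-p / 2) ≤ ‖z‖ ^ (-p) := by
  have hz' : 0 < ‖z‖ := norm_pos_iff.2 hz
  calc (‖z‖ ^ 2 + ε) ^ (-p / 2) ≤ (‖z‖ ^ 2) ^ (-p / 2) :=
        Real.rpow_le_rpow_of_nonpos (by positivity) (by linarith) (by linarith)
    _ = ‖z‖ ^ (-p) := by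
        rw [← Real.rpow_natCast_mul hz'.le]
        congr 1
        push_cast
        ring

lemma norm_sq_add_rpow_le_const (p : ℝ) (hp : 0 ≤ p) {ε : ℝ} (hε : 0 < ε) (z : E) :
    (‖z‖ ^ 2 + ε) ^ (-p / 2) ≤ ε ^ (-p / 2) :=
  Real.rpow_le_rpow_of_nonpos hε (by nlinarith [sq_nonneg ‖z‖]) (by linarith)

lemma continuous_regularizedKernel (p : ℝ) {ε : ℝ} (hε : 0 < ε) :
    Continuous fun z : E × E => (‖z.1 - z.2‖ ^ 2 + ε) ^ (-p / 2) := by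
  refine Continuous.rpow_const (by fun_prop) fun z => Or.inl ?_
  positivity

variable [InnerProductSpace ℝ E]

/-- The derivative in `y` of `(‖x - y‖ ^ 2 + ε) ^ (-p / 2)`. -/
noncomputable def regularizedKernelDeriv (p ε : ℝ) (x y : E) : E →L[ℝ] ℝ :=
  (p * (‖x - y‖ ^ 2 + ε) ^ (-p / 2 - 1)) • innerSL ℝ (x - y)

lemma hasFDerivAt_regularizedKernel (p : ℝ) {ε : ℝ} (hε : 0 < ε) (x y : E) :
    HasFDerivAt (fun y => (‖x - y‖ ^ 2 + ε) ^ (-p / 2)) (regularizedKernelDeriv p ε x y) y := by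
  have h := (((hasFDerivAt_id y).const_sub x).norm_sq.add_const ε).rpow_const
    (p := -p / 2) (Or.inl (by simp only [id]; positivity))
  refine h.congr_fderiv ?_
  ext w
  simp [regularizedKernelDeriv]
  ring

lemma norm_regularizedKernelDeriv_le {p : ℝ} (hp : 0 ≤ p) {ε : ℝ} (hε : 0 < ε) (x y : E) :
    ‖regularizedKernelDeriv p ε x y‖ ≤ p * (‖x - y‖ ^ 2 + ε) ^ (-(p + 1) / 2) := by
  have hpos : 0 < ‖x - y‖ ^ 2 + ε := by positivity
  have hsplit : (‖x - y‖ ^ 2 + ε) ^ (-(p + 1) / 2)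
      = (‖x - y‖ ^ 2 + ε) ^ (-p / 2 - 1) * √(‖x - y‖ ^ 2 + ε) := by
    rw [Real.sqrt_eq_rpow, ← Real.rpow_add hpos]
    congr 1
    ring
  rw [regularizedKernelDeriv, norm_smul, innerSL_apply_norm, Real.norm_of_nonneg (by positivity),
    hsplit, mul_assoc]
  gcongr
  exact Real.le_sqrt_of_sq_le (by linarith)

lemma Continuous.regularizedKernelDeriv (p : ℝ) {ε : ℝ} (hε : 0 < ε) {X : Type*}
    [TopologicalSpace X] {f g : X → E} (hf : Continuous f) (hg : Continuous g) :
    Continuous fun t => regularizedKernelDeriv p ε (f t) (g t) := by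
  unfold _root_.regularizedKernelDeriv
  refine Continuous.smul (continuous_const.mul
    (Continuous.rpow_const (by fun_prop) fun t => Or.inl ?_)) (by fun_prop)
  positivity

variable [FiniteDimensional ℝ E] [MeasurableSpace E] [BorelSpace E]

lemma ae_restrict_sub_ne_zero (hE : 0 < (finrank ℝ E : ℝ)) (s : Set E) (y : E) :
    ∀ᵐ x ∂(volume.restrict s), x - y ≠ 0 := by
  have : Nontrivial E := Module.nontrivial_of_finrank_pos (R := ℝ) (by exact_mod_cast hE)
  exact ae_restrict_of_ae <| (Measure.ae_ne volume y).mono fun x hx => sub_ne_zero.2 hx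

lemma exists_forall_setIntegral_norm_sub_rpow_le {p : ℝ} (hp : 0 ≤ p) (hpE : p < finrank ℝ E)
    (R : ℝ) :
    ∃ C > 0, ∀ y : E, IntegrableOn (fun x => ‖x - y‖ ^ (-p)) (ball 0 R) ∧
      ∫ x in ball (0 : E) R, ‖x - y‖ ^ (-p) ≤ C := by
  have hd : 1 ≤ finrank ℝ E := by
    have : (0 : ℝ) < finrank ℝ E := hp.trans_lt hpE
    exact_mod_cast this
  have hm : Measurable fun z : E => ‖z‖ ^ (-p) := by fun_prop
  set g : E → ℝ := (ball (0 : E) 1).indicator fun z => ‖z‖ ^ (-p) with hg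
  have hg0 : ∀ z, 0 ≤ g z := fun z => indicator_nonneg (fun z _ => by positivity) z
  have hgi : Integrable g := by
    rw [hg, integrable_indicator_iff measurableSet_ball]
    refine integrableOn_ball_of_norm_le_rpow hd hpE (C := 1) (ae_of_all _ fun x => ?_)
      hm.aestronglyMeasurable
    rw [one_mul, Real.norm_of_nonneg (by positivity)]
  have hle : ∀ x y : E, ‖x - y‖ ^ (-p) ≤ 1 + g (x - y) := by
    intro x y
    by_cases h : x - y ∈ ball (0 : E) 1
    · simp [hg, indicator_of_mem h]
    · have h1 : 1 ≤ ‖x - y‖ := by simpa using h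
      have := Real.rpow_le_one_of_one_le_of_nonpos h1 (neg_nonpos.2 hp)
      linarith [hg0 (x - y)]
  have h1 : IntegrableOn (fun _ : E => (1 : ℝ)) (ball 0 R) :=
    integrableOn_const measure_ball_lt_top.ne
  have hgy : ∀ y, Integrable fun x => g (x - y) := fun y => hgi.comp_sub_right y
  have hint : ∀ y : E, IntegrableOn (fun x => ‖x - y‖ ^ (-p)) (ball 0 R) := by
    intro y
    refine Integrable.mono' (h1.add (hgy y).integrableOn) ?_ (ae_of_all _ fun x => ?_)
    · exact (hm.comp (measurable_id.sub_const y)).aestronglyMeasurable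
    · rw [Real.norm_of_nonneg (by positivity)]
      exact hle x y
  refine ⟨volume.real (ball (0 : E) R) + (∫ z, g z) + 1, ?_, fun y => ⟨hint y, ?_⟩⟩
  · have := integral_nonneg (μ := volume) (f := g) hg0
    positivity
  · calc ∫ x in ball (0 : E) R, ‖x - y‖ ^ (-p)
        ≤ ∫ x in ball (0 : E) R, (1 + g (x - y)) :=
          integral_mono (hint y) (h1.add (hgy y).integrableOn) fun x => hle x y
      _ = volume.real (ball (0 : E) R) + ∫ x in ball (0 : E) R, g (x - y) := by
          rw [integral_add h1 (hgy y).integrableOn]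
          simp
      _ ≤ volume.real (ball (0 : E) R) + ∫ x, g (x - y) := by
          gcongr
          · exact ae_of_all _ fun x => hg0 _
          · exact hgy y
          · exact Measure.restrict_le_self
      _ ≤ _ := by
          rw [integral_sub_right_eq_self g y]
          linarith

/-- Mollified potentials of densities bounded by `1` on a ball are `C¹`, with sup norms of the
function and of its gradient bounded uniformly in the density and the mollification. -/
lemma exists_forall_regularizedPotential_le {p : ℝ} (hp : 0 ≤ p) (hpE : p + 1 < finrank ℝ E)
    (R : ℝ) :
    ∃ C > 0, ∀ Φ : E → ℝ, Measurable Φ → (∀ x, |Φ x| ≤ 1) → ∀ ε > 0,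
      ContDiff ℝ 1 (fun y => ∫ x in ball 0 R, Φ x * (‖x - y‖ ^ 2 + ε) ^ (-p / 2)) ∧
      (∀ y, |∫ x in ball 0 R, Φ x * (‖x - y‖ ^ 2 + ε) ^ (-p / 2)| ≤ C) ∧
      ∀ y, ‖fderiv ℝ (fun y => ∫ x in ball 0 R, Φ x * (‖x - y‖ ^ 2 + ε) ^ (-p / 2)) y‖ ≤ C := by
  obtain ⟨C₀, hC₀, h₀⟩ := exists_forall_setIntegral_norm_sub_rpow_le (E := E) hp (by linarith) R
  obtain ⟨C₁, hC₁, h₁⟩ :=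
    exists_forall_setIntegral_norm_sub_rpow_le (E := E) (p := p + 1) (by linarith) hpE R
  have hne := ae_restrict_sub_ne_zero (E := E) (by linarith) (ball 0 R)
  refine ⟨C₀ + p * C₁, by positivity, fun Φ hΦ hΦ1 ε hε => ?_⟩
  have hcK : ∀ y : E, Measurable fun x : E => (‖x - y‖ ^ 2 + ε) ^ (-p / 2) := fun y =>
    ((continuous_regularizedKernel p hε).comp (continuous_id.prodMk continuous_const)).measurable
  have hcD : ∀ y : E, Continuous fun x : E => regularizedKernelDeriv p ε x y := fun y =>
    continuous_id.regularizedKernelDeriv p hε continuous_const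
  have hbK : ∀ x y : E, ‖Φ x * (‖x - y‖ ^ 2 + ε) ^ (-p / 2)‖ ≤ (‖x - y‖ ^ 2 + ε) ^ (-p / 2) := by
    intro x y
    rw [norm_mul, Real.norm_of_nonneg (r := _ ^ _) (by positivity)]
    exact mul_le_of_le_one_left (by positivity) (hΦ1 x)
  have hbD : ∀ x y : E, ‖Φ x • regularizedKernelDeriv p ε x y‖
      ≤ p * (‖x - y‖ ^ 2 + ε) ^ (-(p + 1) / 2) := by
    intro x y
    rw [norm_smul]
    exact (mul_le_of_le_one_left (norm_nonneg _) (hΦ1 x)).trans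
      (norm_regularizedKernelDeriv_le hp hε x y)
  have hbD' : ∀ x y : E, ‖Φ x • regularizedKernelDeriv p ε x y‖
      ≤ p * ε ^ (-(p + 1) / 2) := fun x y => (hbD x y).trans <|
    mul_le_mul_of_nonneg_left (norm_sq_add_rpow_le_const (p + 1) (by linarith) hε (x - y)) hp
  have hconst : ∀ c : ℝ, Integrable (fun _ => c) (volume.restrict (ball (0 : E) R)) := fun c =>
    integrableOn_const measure_ball_lt_top.ne
  have hKm : ∀ y : E, AEStronglyMeasurable (fun x => Φ x * (‖x - y‖ ^ 2 + ε) ^ (-p / 2))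
      (volume.restrict (ball (0 : E) R)) := fun y => (hΦ.mul (hcK y)).aestronglyMeasurable
  have hDm : ∀ y : E, AEStronglyMeasurable (fun x => Φ x • regularizedKernelDeriv p ε x y)
      (volume.restrict (ball (0 : E) R)) := fun y =>
    hΦ.aestronglyMeasurable.smul (hcD y).aestronglyMeasurable
  have hderiv : ∀ y, HasFDerivAt
      (fun y => ∫ x in ball 0 R, Φ x * (‖x - y‖ ^ 2 + ε) ^ (-p / 2))
      (∫ x in ball 0 R, Φ x • regularizedKernelDeriv p ε x y) y := by
    intro y
    refine hasFDerivAt_integral_of_dominated_of_fderiv_le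
      (F := fun y x => Φ x * (‖x - y‖ ^ 2 + ε) ^ (-p / 2))
      (F' := fun y x => Φ x • regularizedKernelDeriv p ε x y)
      (bound := fun _ => p * ε ^ (-(p + 1) / 2)) (s := univ) univ_mem
      (Eventually.of_forall hKm) ?_ (hDm y)
      (ae_of_all _ fun x y _ => hbD' x y) (hconst _) (ae_of_all _ fun x y _ => ?_)
    · exact (hconst (ε ^ (-p / 2))).mono' (hKm y) <| ae_of_all _ fun x =>
        (hbK x y).trans (norm_sq_add_rpow_le_const p hp hε (x - y))
    · exact (hasFDerivAt_regularizedKernel p hε x y).const_mul (Φ x)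
  refine ⟨?_, fun y => ?_, fun y => ?_⟩
  · rw [contDiff_one_iff_fderiv]
    refine ⟨fun y => (hderiv y).differentiableAt, ?_⟩
    rw [funext fun y => (hderiv y).fderiv]
    exact continuous_of_dominated hDm (bound := fun _ => p * ε ^ (-(p + 1) / 2))
      (fun y => ae_of_all _ fun x => hbD' x y) (hconst _)
      (ae_of_all _ fun x =>
        (continuous_const.regularizedKernelDeriv p hε continuous_id).const_smul (Φ x))
  · have h : ‖∫ x in ball 0 R, Φ x * (‖x - y‖ ^ 2 + ε) ^ (-p / 2)‖
        ≤ ∫ x in ball (0 : E) R, ‖x - y‖ ^ (-p) :=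
      norm_integral_le_of_norm_le (h₀ y).1 <| (hne y).mono fun x hx =>
        (hbK x y).trans (norm_sq_add_rpow_le p hp hε hx)
    rw [Real.norm_eq_abs] at h
    have := (h₀ y).2
    have : 0 ≤ p * C₁ := by positivity
    linarith
  · rw [(hderiv y).fderiv]
    have h : ‖∫ x in ball 0 R, Φ x • regularizedKernelDeriv p ε x y‖
        ≤ ∫ x in ball (0 : E) R, p * ‖x - y‖ ^ (-(p + 1)) :=
      norm_integral_le_of_norm_le ((h₁ y).1.const_mul p) <| (hne y).mono fun x hx =>
        (hbD x y).trans (by gcongr; exact norm_sq_add_rpow_le (p + 1) (by linarith) hε hx)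
    rw [integral_const_mul] at h
    have := mul_le_mul_of_nonneg_left (h₁ y).2 hp
    linarith

lemma integrable_norm_sub_rpow_prod {p : ℝ} (hp : 0 ≤ p) (hpE : p < finrank ℝ E) (R : ℝ)
    (μ : Measure E) [IsFiniteMeasure μ] :
    Integrable (fun z : E × E => ‖z.1 - z.2‖ ^ (-p)) ((volume.restrict (ball 0 R)).prod μ) := by
  obtain ⟨C, hC, h⟩ := exists_forall_setIntegral_norm_sub_rpow_le (E := E) hp hpE R
  have hm : Measurable fun z : E × E => ‖z.1 - z.2‖ ^ (-p) := by fun_prop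
  rw [integrable_prod_iff' hm.aestronglyMeasurable]
  refine ⟨ae_of_all _ fun y => (h y).1, ?_⟩
  refine (integrable_const C).mono'
    hm.norm.stronglyMeasurable.integral_prod_left'.aestronglyMeasurable (ae_of_all _ fun y => ?_)
  rw [Real.norm_of_nonneg (integral_nonneg fun _ => norm_nonneg _)]
  refine le_of_eq_of_le (integral_congr_ae <| ae_of_all _ fun x => ?_) (h y).2
  exact Real.norm_of_nonneg (by positivity)

/-- The regularized potentials of a bounded density converge, after integration against a finite
measure `μ`, to the pairing of the density with the potential of `μ`. -/
lemma tendsto_integral_regularizedPotential {p : ℝ} (hp : 0 ≤ p) (hpE : p + 1 < finrank ℝ E)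
    (R : ℝ) (μ : Measure E) [IsFiniteMeasure μ] {Φ : E → ℝ} (hΦ : Measurable Φ)
    (hΦ1 : ∀ x, |Φ x| ≤ 1) :
    Tendsto (fun ε => ∫ y, (∫ x in ball 0 R, Φ x * (‖x - y‖ ^ 2 + ε) ^ (-p / 2)) ∂μ) (𝓝[>] 0)
      (𝓝 (∫ x in ball 0 R, Φ x * ∫ y, ‖x - y‖ ^ (-p) ∂μ)) := by
  obtain ⟨C, hC, h⟩ := exists_forall_regularizedPotential_le (E := E) hp hpE R
  obtain ⟨C₀, hC₀, h₀⟩ := exists_forall_setIntegral_norm_sub_rpow_le (E := E) hp (by linarith) R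
  have hne := ae_restrict_sub_ne_zero (E := E) (by linarith) (ball 0 R)
  have hswap : ∫ x in ball 0 R, Φ x * ∫ y, ‖x - y‖ ^ (-p) ∂μ
      = ∫ y, (∫ x in ball 0 R, Φ x * ‖x - y‖ ^ (-p)) ∂μ := by
    simp_rw [← integral_const_mul]
    refine integral_integral_swap ?_
    refine (integrable_norm_sub_rpow_prod hp (by linarith) R μ).bdd_mul (c := 1)
      (f := fun z : E × E => Φ z.1) (hΦ.comp measurable_fst).aestronglyMeasurable
      (ae_of_all _ fun z => hΦ1 z.1)
  rw [hswap]
  refine tendsto_integral_filter_of_dominated_convergence (fun _ => C) ?_ ?_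
    (integrable_const C) (ae_of_all _ fun y => ?_)
  · filter_upwards [self_mem_nhdsWithin] with ε hε
    exact (h Φ hΦ hΦ1 ε hε).1.continuous.aestronglyMeasurable
  · filter_upwards [self_mem_nhdsWithin] with ε hε
    exact ae_of_all _ (h Φ hΦ hΦ1 ε hε).2.1
  · refine tendsto_integral_filter_of_dominated_convergence (fun x => ‖x - y‖ ^ (-p)) ?_ ?_
      (h₀ y).1 ?_
    · refine Eventually.of_forall fun ε => (hΦ.mul ?_).aestronglyMeasurable
      fun_prop
    · filter_upwards [self_mem_nhdsWithin] with ε (hε : 0 < ε)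
      filter_upwards [hne y] with x hx
      rw [norm_mul, Real.norm_of_nonneg (r := _ ^ _) (by positivity)]
      exact (mul_le_of_le_one_left (by positivity) (hΦ1 x)).trans (norm_sq_add_rpow_le p hp hε hx)
    · filter_upwards [hne y] with x hx
      have hx' : 0 < ‖x - y‖ := norm_pos_iff.2 hx
      have hlim : Tendsto (fun ε : ℝ => Φ x * (‖x - y‖ ^ 2 + ε) ^ (-p / 2)) (𝓝 0)
          (𝓝 (Φ x * (‖x - y‖ ^ 2 + 0) ^ (-p / 2))) := by
        refine Tendsto.const_mul _ (Tendsto.rpow_const (tendsto_id.const_add _) (Or.inl ?_))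
        positivity
      convert hlim.mono_left nhdsWithin_le_nhds using 3
      rw [add_zero, ← Real.rpow_natCast_mul hx'.le]
      congr 1
      push_cast
      ring

lemma ae_integrable_norm_sub_rpow {p : ℝ} (hp : 0 ≤ p) (hpE : p < finrank ℝ E)
    (μ : Measure E) [IsFiniteMeasure μ] :
    ∀ᵐ x : E, Integrable (fun y => ‖x - y‖ ^ (-p)) μ := by
  have h : ∀ n : ℕ, ∀ᵐ x : E, x ∈ ball (0 : E) n → Integrable (fun y => ‖x - y‖ ^ (-p)) μ :=
    fun n => (ae_restrict_iff' measurableSet_ball).1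
      (integrable_norm_sub_rpow_prod hp hpE n μ).prod_right_ae
  filter_upwards [ae_all_iff.2 h] with x hx
  obtain ⟨n, hn⟩ := exists_nat_gt ‖x‖
  exact hx n (by simpa using hn)

/-- The `L¹` norm on a ball of the potential of `μ₁ - μ₂` is controlled by the dual `C¹` norm of
`μ₁ - μ₂`: pair the potential with its sign and regularize the kernel. -/
lemma setIntegral_abs_potential_sub_le {p : ℝ} (hp : 0 ≤ p) (hpE : p + 1 < finrank ℝ E)
    (R : ℝ) (μ₁ μ₂ : Measure E) [IsFiniteMeasure μ₁] [IsFiniteMeasure μ₂] {C : ℝ} (hC : 0 < C)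
    (h : ∀ Φ : E → ℝ, Measurable Φ → (∀ x, |Φ x| ≤ 1) → ∀ ε > 0,
      ContDiff ℝ 1 (fun y => ∫ x in ball 0 R, Φ x * (‖x - y‖ ^ 2 + ε) ^ (-p / 2)) ∧
      (∀ y, |∫ x in ball 0 R, Φ x * (‖x - y‖ ^ 2 + ε) ^ (-p / 2)| ≤ C) ∧
      ∀ y, ‖fderiv ℝ (fun y => ∫ x in ball 0 R, Φ x * (‖x - y‖ ^ 2 + ε) ^ (-p / 2)) y‖ ≤ C) :
    ∫ x in ball (0 : E) R, |(∫ y, ‖x - y‖ ^ (-p) ∂μ₁) - ∫ y, ‖x - y‖ ^ (-p) ∂μ₂|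
      ≤ C * sSup {r : ℝ | ∃ Ψ : E → ℝ, ContDiff ℝ 1 Ψ ∧ (∀ x, |Ψ x| ≤ 1) ∧
          (∀ x, ‖fderiv ℝ Ψ x‖ ≤ 1) ∧ r = |(∫ x, Ψ x ∂μ₁) - ∫ x, Ψ x ∂μ₂|} := by
  set S : Set ℝ := {r : ℝ | ∃ Ψ : E → ℝ, ContDiff ℝ 1 Ψ ∧ (∀ x, |Ψ x| ≤ 1) ∧
    (∀ x, ‖fderiv ℝ Ψ x‖ ≤ 1) ∧ r = |(∫ x, Ψ x ∂μ₁) - ∫ x, Ψ x ∂μ₂|}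
  have hbdd : BddAbove S := by
    refine ⟨μ₁.real univ + μ₂.real univ, ?_⟩
    rintro r ⟨Ψ, -, hΨ, -, rfl⟩
    have h₁ : ‖∫ x, Ψ x ∂μ₁‖ ≤ 1 * μ₁.real univ :=
      norm_integral_le_of_norm_le_const (ae_of_all _ hΨ)
    have h₂ : ‖∫ x, Ψ x ∂μ₂‖ ≤ 1 * μ₂.real univ :=
      norm_integral_le_of_norm_le_const (ae_of_all _ hΨ)
    rw [one_mul] at h₁ h₂
    exact (norm_sub_le _ _).trans (add_le_add h₁ h₂)
  have hker : Measurable fun z : E × E => ‖z.1 - z.2‖ ^ (-p) := by fun_prop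
  set v : E → ℝ := fun x => (∫ y, ‖x - y‖ ^ (-p) ∂μ₁) - ∫ y, ‖x - y‖ ^ (-p) ∂μ₂
  have hvm : Measurable v := hker.stronglyMeasurable.integral_prod_right'.measurable.sub
    hker.stronglyMeasurable.integral_prod_right'.measurable
  set Φ : E → ℝ := fun x => if 0 ≤ v x then 1 else -1 with hΦ
  have hΦm : Measurable Φ :=
    Measurable.ite (measurableSet_le measurable_const hvm) measurable_const measurable_const
  have hΦ1 : ∀ x, |Φ x| ≤ 1 := by
    intro x
    simp only [hΦ]
    split_ifs <;> simp
  have habs : ∀ x, |v x| = Φ x * v x := by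
    intro x
    simp only [hΦ]
    split_ifs with hx
    · rw [abs_of_nonneg hx, one_mul]
    · rw [abs_of_neg (not_le.1 hx), neg_one_mul]
  have hint : ∀ (μ : Measure E) [IsFiniteMeasure μ],
      IntegrableOn (fun x => Φ x * ∫ y, ‖x - y‖ ^ (-p) ∂μ) (ball 0 R) := fun μ _ =>
    (integrable_norm_sub_rpow_prod hp (by linarith) R μ).integral_prod_left.bdd_mul (c := 1)
      hΦm.aestronglyMeasurable (ae_of_all _ hΦ1)
  have hpair : ∫ x in ball (0 : E) R, |v x|
      = (∫ x in ball 0 R, Φ x * ∫ y, ‖x - y‖ ^ (-p) ∂μ₁)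
        - ∫ x in ball 0 R, Φ x * ∫ y, ‖x - y‖ ^ (-p) ∂μ₂ := by
    rw [← integral_sub (hint μ₁) (hint μ₂)]
    exact integral_congr_ae (ae_of_all _ fun x => (habs x).trans (mul_sub _ _ _))
  change ∫ x in ball (0 : E) R, |v x| ≤ C * sSup S
  rw [hpair]
  refine le_of_tendsto ((tendsto_integral_regularizedPotential hp hpE R μ₁ hΦm hΦ1).sub
    (tendsto_integral_regularizedPotential hp hpE R μ₂ hΦm hΦ1)) ?_
  filter_upwards [self_mem_nhdsWithin] with ε hε
  obtain ⟨hU, hU0, hU1⟩ := h Φ hΦm hΦ1 ε hε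
  set U : E → ℝ := fun y => ∫ x in ball 0 R, Φ x * (‖x - y‖ ^ 2 + ε) ^ (-p / 2)
  have hmem : |(∫ y, C⁻¹ * U y ∂μ₁) - ∫ y, C⁻¹ * U y ∂μ₂| ∈ S := by
    refine ⟨fun y => C⁻¹ * U y, contDiff_const.mul hU, fun y => ?_, fun y => ?_, rfl⟩
    · rw [abs_mul, abs_of_pos (inv_pos.2 hC), inv_mul_le_one₀ hC]
      exact hU0 y
    · rw [fderiv_const_mul (hU.differentiable one_ne_zero y), norm_smul,
        Real.norm_of_nonneg (inv_pos.2 hC).le, inv_mul_le_one₀ hC]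
      exact hU1 y
  have hle := le_csSup hbdd hmem
  rw [integral_const_mul, integral_const_mul, ← mul_sub, abs_mul, abs_of_pos (inv_pos.2 hC),
    inv_mul_le_iff₀ hC] at hle
  exact (le_abs_self _).trans hle

end RieszPotential

/-- The Newtonian potential `v(x) = ∫ |x−y|^{2−N} dν(y)` of a finite signed measure `ν`
supported in the closed unit ball of `ℝ^N`, `N ≥ 3`, is defined a.e., integrable on
`B(0,2)`, and `∫_{B(0,2)} |v| ≤ C ·` (dual `C¹` norm of `ν`), with `C` depending only
on `N`. The integral against `ν` is taken via the Jordan decomposition. -/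
theorem stmt_13 (N : ℕ) (hN : 3 ≤ N) :
    ∃ C > 0, ∀ ν : MeasureTheory.SignedMeasure (EuclideanSpace ℝ (Fin N)),
      (∀ A : Set (EuclideanSpace ℝ (Fin N)), MeasurableSet A →
        A ∩ Metric.closedBall 0 1 = ∅ → ν A = 0) →
      (∀ᵐ x : EuclideanSpace ℝ (Fin N),
        Integrable (fun y => ‖x - y‖ ^ ((2 : ℝ) - N)) ν.totalVariation) ∧
      IntegrableOn
        (fun x => (∫ y, ‖x - y‖ ^ ((2 : ℝ) - N) ∂ν.toJordanDecomposition.posPart) -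
          ∫ y, ‖x - y‖ ^ ((2 : ℝ) - N) ∂ν.toJordanDecomposition.negPart)
        (Metric.ball 0 2) volume ∧
      (∫ x in Metric.ball (0 : EuclideanSpace ℝ (Fin N)) 2,
          |(∫ y, ‖x - y‖ ^ ((2 : ℝ) - N) ∂ν.toJordanDecomposition.posPart) -
            ∫ y, ‖x - y‖ ^ ((2 : ℝ) - N) ∂ν.toJordanDecomposition.negPart|)
        ≤ C * sSup {r : ℝ | ∃ Ψ : EuclideanSpace ℝ (Fin N) → ℝ,
            ContDiff ℝ 1 Ψ ∧ (∀ x, |Ψ x| ≤ 1) ∧ (∀ x, ‖fderiv ℝ Ψ x‖ ≤ 1) ∧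
            r = |(∫ x, Ψ x ∂ν.toJordanDecomposition.posPart) -
                  ∫ x, Ψ x ∂ν.toJordanDecomposition.negPart|} := by
  have hp : (0 : ℝ) ≤ N - 2 := by
    have : (3 : ℝ) ≤ N := by exact_mod_cast hN
    linarith
  have hpE : (N - 2 : ℝ) + 1 < finrank ℝ (EuclideanSpace ℝ (Fin N)) := by
    rw [finrank_euclideanSpace_fin]
    linarith
  have hneg : (2 : ℝ) - N = -(N - 2) := by ring
  simp only [hneg]
  obtain ⟨C, hC, h⟩ :=
    exists_forall_regularizedPotential_le (E := EuclideanSpace ℝ (Fin N)) hp hpE 2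
  refine ⟨C, hC, fun ν _ => ⟨ae_integrable_norm_sub_rpow hp (by linarith) _, ?_, ?_⟩⟩
  · exact (integrable_norm_sub_rpow_prod hp (by linarith) 2 _).integral_prod_left.sub
      (integrable_norm_sub_rpow_prod hp (by linarith) 2 _).integral_prod_left
  · exact setIntegral_abs_potential_sub_le hp hpE 2 _ _ hC h
end
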